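/- arXiv:1008.4707 — 9 statements merged into one kernel-verified Lean document; each statement's English description precedes it below -/
import Mathlib

section
/- For every ε > 0 there exists N such that for every n ≥ N, every orgraph Γ on n vertices (not necessarily C⃗4-free) satisfies: the number of edges of FDF(Γ) is at least (7/16 − ε)·C(n,3). -/
open Finset

/-- `E` is an orgraph relation: no loops and no pair of opposite edges. -/
def IsOrgraph {V : Type*} (E : V → V → Prop) : Prop :=
  (∀ v, ¬ E v v) ∧ ∀ v w, E v w → ¬ E w v

/-- `E` contains an induced (oriented) 4-cycle: four distinct vertices whose
induced sub-orgraph has edge set exactly the oriented cycle. -/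
def HasInducedC4 {V : Type*} (E : V → V → Prop) : Prop :=
  ∃ v₁ v₂ v₃ v₄ : V,
    v₁ ≠ v₂ ∧ v₁ ≠ v₃ ∧ v₁ ≠ v₄ ∧ v₂ ≠ v₃ ∧ v₂ ≠ v₄ ∧ v₃ ≠ v₄ ∧
    E v₁ v₂ ∧ E v₂ v₃ ∧ E v₃ v₄ ∧ E v₄ v₁ ∧
    ¬ E v₂ v₁ ∧ ¬ E v₃ v₂ ∧ ¬ E v₄ v₃ ∧ ¬ E v₁ v₄ ∧
    ¬ E v₁ v₃ ∧ ¬ E v₃ v₁ ∧ ¬ E v₂ v₄ ∧ ¬ E v₄ v₂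

/-- The triple `{u,v,w}` spans an edge of `FDF(Γ)`: within the triple, some
vertex has out-degree 2, or some vertex has in-degree 0 and out-degree 0. -/
def FDFedge {V : Type*} (E : V → V → Prop) (u v w : V) : Prop :=
  (E u v ∧ E u w) ∨ (E v u ∧ E v w) ∨ (E w u ∧ E w v) ∨
  (¬ E u v ∧ ¬ E v u ∧ ¬ E u w ∧ ¬ E w u) ∨
  (¬ E v u ∧ ¬ E u v ∧ ¬ E v w ∧ ¬ E w v) ∨
  (¬ E w u ∧ ¬ E u w ∧ ¬ E w v ∧ ¬ E v w)

-- The number of edges of the 3-graph `FDF(Γ)`. 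
open Classical in
noncomputable def fdfCount (V : Type*) [Fintype V] (E : V → V → Prop) : ℕ :=
  ((Finset.univ.powersetCard 3).filter (fun s : Finset V =>
    ∃ u v w : V, u ≠ v ∧ u ≠ w ∧ v ≠ w ∧ s = {u, v, w} ∧ FDFedge E u v w)).card

-- The number of edges of the undirected graph underlying the orgraph `E`. 
open Classical in
noncomputable def underlyingEdgeCount (V : Type*) [Fintype V] (E : V → V → Prop) : ℕ :=
  ((Finset.univ.powersetCard 2).filter (fun s : Finset V =>
    ∃ u v : V, u ≠ v ∧ s = {u, v} ∧ (E u v ∨ E v u))).card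

/-- 0/1 value of a Boolean. -/
def bi (a : Bool) : ℤ := if a then 1 else 0

/-- at least two edges in a triple -/
def h3 (a b c : Bool) : ℤ := if (a && b) || (a && c) || (b && c) then 1 else 0

/-- first linear form (doubled) -/
def l1 (a b c : Bool) : ℤ :=
  if !a && !b && !c then 2 else if (xor a b) && c then -1 else 0

/-- second linear form -/
def l2 (a b c : Bool) : ℤ :=
  if !a && !b && !c then 1 else if a && b then (if c then 1 else -1) else 0

/-- the five-vertex kernel, rooted at `v`, with pairs `{x,y}` and `{z,w}` -/
def K5 (vx vy vz vw xy zw : Bool) : ℤ :=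
  9 - 8 * h3 vx vy xy - 8 * h3 vz vw zw + 12 * (bi xy * bi zw)
    - l1 vx vy xy * l1 vz vw zw - 5 * (l2 vx vy xy * l2 vz vw zw)

theorem K5_sum : ∀ b01 b02 b03 b04 b12 b13 b14 b23 b24 b34 : Bool,
    0 ≤ K5 b01 b02 b03 b04 b12 b34 +
      K5 b01 b03 b02 b04 b13 b24 +
      K5 b01 b04 b02 b03 b14 b23 +
      K5 b01 b12 b13 b14 b02 b34 +
      K5 b01 b13 b12 b14 b03 b24 +
      K5 b01 b14 b12 b13 b04 b23 +
      K5 b02 b12 b23 b24 b01 b34 +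
      K5 b02 b23 b12 b24 b03 b14 +
      K5 b02 b24 b12 b23 b04 b13 +
      K5 b03 b13 b23 b34 b01 b24 +
      K5 b03 b23 b13 b34 b02 b14 +
      K5 b03 b34 b13 b23 b04 b12 +
      K5 b04 b14 b24 b34 b01 b23 +
      K5 b04 b24 b14 b34 b02 b13 +
      K5 b04 b34 b14 b24 b03 b12 := by
  decide +kernel


/-- the kernel evaluated at five vertices of a graph -/
def KF {V : Type*} (A : V → V → Bool) (v x y z w : V) : ℤ :=
  K5 (A v x) (A v y) (A v z) (A v w) (A x y) (A z w)

theorem sum_perm_nonneg {V : Type*} [Fintype V] (F : V → V → V → V → V → ℤ)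
    (hF : ∀ a b c d e, 0 ≤ F a b c d e +
      F a b d c e +
      F a b e c d +
      F b a c d e +
      F b a d c e +
      F b a e c d +
      F c a b d e +
      F c a d b e +
      F c a e b d +
      F d a b c e +
      F d a c b e +
      F d a e b c +
      F e a b c d +
      F e a c b d +
      F e a d b c) :
    0 ≤ ∑ q : V × (V × V) × (V × V), F q.1 q.2.1.1 q.2.1.2 q.2.2.1 q.2.2.2 := by
  have e1 : ∑ q : V × (V × V) × (V × V), F q.1 q.2.1.1 q.2.2.1 q.2.1.2 q.2.2.2
      = ∑ q : V × (V × V) × (V × V), F q.1 q.2.1.1 q.2.1.2 q.2.2.1 q.2.2.2 :=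
    Fintype.sum_equiv (⟨fun q => (q.1, (q.2.1.1, q.2.2.1), (q.2.1.2, q.2.2.2)),
      fun q => (q.1, (q.2.1.1, q.2.2.1), (q.2.1.2, q.2.2.2)),
      fun _ => rfl, fun _ => rfl⟩ : V × (V × V) × (V × V) ≃ V × (V × V) × (V × V)) _ _ (fun _ => rfl)
  have e2 : ∑ q : V × (V × V) × (V × V), F q.1 q.2.1.1 q.2.2.2 q.2.1.2 q.2.2.1
      = ∑ q : V × (V × V) × (V × V), F q.1 q.2.1.1 q.2.1.2 q.2.2.1 q.2.2.2 :=
    Fintype.sum_equiv (⟨fun q => (q.1, (q.2.1.1, q.2.2.2), (q.2.1.2, q.2.2.1)),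
      fun q => (q.1, (q.2.1.1, q.2.2.1), (q.2.2.2, q.2.1.2)),
      fun _ => rfl, fun _ => rfl⟩ : V × (V × V) × (V × V) ≃ V × (V × V) × (V × V)) _ _ (fun _ => rfl)
  have e3 : ∑ q : V × (V × V) × (V × V), F q.2.1.1 q.1 q.2.1.2 q.2.2.1 q.2.2.2
      = ∑ q : V × (V × V) × (V × V), F q.1 q.2.1.1 q.2.1.2 q.2.2.1 q.2.2.2 :=
    Fintype.sum_equiv (⟨fun q => (q.2.1.1, (q.1, q.2.1.2), (q.2.2.1, q.2.2.2)),
      fun q => (q.2.1.1, (q.1, q.2.1.2), (q.2.2.1, q.2.2.2)),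
      fun _ => rfl, fun _ => rfl⟩ : V × (V × V) × (V × V) ≃ V × (V × V) × (V × V)) _ _ (fun _ => rfl)
  have e4 : ∑ q : V × (V × V) × (V × V), F q.2.1.1 q.1 q.2.2.1 q.2.1.2 q.2.2.2
      = ∑ q : V × (V × V) × (V × V), F q.1 q.2.1.1 q.2.1.2 q.2.2.1 q.2.2.2 :=
    Fintype.sum_equiv (⟨fun q => (q.2.1.1, (q.1, q.2.2.1), (q.2.1.2, q.2.2.2)),
      fun q => (q.2.1.1, (q.1, q.2.2.1), (q.2.1.2, q.2.2.2)),
      fun _ => rfl, fun _ => rfl⟩ : V × (V × V) × (V × V) ≃ V × (V × V) × (V × V)) _ _ (fun _ => rfl)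
  have e5 : ∑ q : V × (V × V) × (V × V), F q.2.1.1 q.1 q.2.2.2 q.2.1.2 q.2.2.1
      = ∑ q : V × (V × V) × (V × V), F q.1 q.2.1.1 q.2.1.2 q.2.2.1 q.2.2.2 :=
    Fintype.sum_equiv (⟨fun q => (q.2.1.1, (q.1, q.2.2.2), (q.2.1.2, q.2.2.1)),
      fun q => (q.2.1.1, (q.1, q.2.2.1), (q.2.2.2, q.2.1.2)),
      fun _ => rfl, fun _ => rfl⟩ : V × (V × V) × (V × V) ≃ V × (V × V) × (V × V)) _ _ (fun _ => rfl)
  have e6 : ∑ q : V × (V × V) × (V × V), F q.2.1.2 q.1 q.2.1.1 q.2.2.1 q.2.2.2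
      = ∑ q : V × (V × V) × (V × V), F q.1 q.2.1.1 q.2.1.2 q.2.2.1 q.2.2.2 :=
    Fintype.sum_equiv (⟨fun q => (q.2.1.2, (q.1, q.2.1.1), (q.2.2.1, q.2.2.2)),
      fun q => (q.2.1.1, (q.2.1.2, q.1), (q.2.2.1, q.2.2.2)),
      fun _ => rfl, fun _ => rfl⟩ : V × (V × V) × (V × V) ≃ V × (V × V) × (V × V)) _ _ (fun _ => rfl)
  have e7 : ∑ q : V × (V × V) × (V × V), F q.2.1.2 q.1 q.2.2.1 q.2.1.1 q.2.2.2
      = ∑ q : V × (V × V) × (V × V), F q.1 q.2.1.1 q.2.1.2 q.2.2.1 q.2.2.2 :=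
    Fintype.sum_equiv (⟨fun q => (q.2.1.2, (q.1, q.2.2.1), (q.2.1.1, q.2.2.2)),
      fun q => (q.2.1.1, (q.2.2.1, q.1), (q.2.1.2, q.2.2.2)),
      fun _ => rfl, fun _ => rfl⟩ : V × (V × V) × (V × V) ≃ V × (V × V) × (V × V)) _ _ (fun _ => rfl)
  have e8 : ∑ q : V × (V × V) × (V × V), F q.2.1.2 q.1 q.2.2.2 q.2.1.1 q.2.2.1
      = ∑ q : V × (V × V) × (V × V), F q.1 q.2.1.1 q.2.1.2 q.2.2.1 q.2.2.2 :=
    Fintype.sum_equiv (⟨fun q => (q.2.1.2, (q.1, q.2.2.2), (q.2.1.1, q.2.2.1)),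
      fun q => (q.2.1.1, (q.2.2.1, q.1), (q.2.2.2, q.2.1.2)),
      fun _ => rfl, fun _ => rfl⟩ : V × (V × V) × (V × V) ≃ V × (V × V) × (V × V)) _ _ (fun _ => rfl)
  have e9 : ∑ q : V × (V × V) × (V × V), F q.2.2.1 q.1 q.2.1.1 q.2.1.2 q.2.2.2
      = ∑ q : V × (V × V) × (V × V), F q.1 q.2.1.1 q.2.1.2 q.2.2.1 q.2.2.2 :=
    Fintype.sum_equiv (⟨fun q => (q.2.2.1, (q.1, q.2.1.1), (q.2.1.2, q.2.2.2)),
      fun q => (q.2.1.1, (q.2.1.2, q.2.2.1), (q.1, q.2.2.2)),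
      fun _ => rfl, fun _ => rfl⟩ : V × (V × V) × (V × V) ≃ V × (V × V) × (V × V)) _ _ (fun _ => rfl)
  have e10 : ∑ q : V × (V × V) × (V × V), F q.2.2.1 q.1 q.2.1.2 q.2.1.1 q.2.2.2
      = ∑ q : V × (V × V) × (V × V), F q.1 q.2.1.1 q.2.1.2 q.2.2.1 q.2.2.2 :=
    Fintype.sum_equiv (⟨fun q => (q.2.2.1, (q.1, q.2.1.2), (q.2.1.1, q.2.2.2)),
      fun q => (q.2.1.1, (q.2.2.1, q.2.1.2), (q.1, q.2.2.2)),
      fun _ => rfl, fun _ => rfl⟩ : V × (V × V) × (V × V) ≃ V × (V × V) × (V × V)) _ _ (fun _ => rfl)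
  have e11 : ∑ q : V × (V × V) × (V × V), F q.2.2.1 q.1 q.2.2.2 q.2.1.1 q.2.1.2
      = ∑ q : V × (V × V) × (V × V), F q.1 q.2.1.1 q.2.1.2 q.2.2.1 q.2.2.2 :=
    Fintype.sum_equiv (⟨fun q => (q.2.2.1, (q.1, q.2.2.2), (q.2.1.1, q.2.1.2)),
      fun q => (q.2.1.1, (q.2.2.1, q.2.2.2), (q.1, q.2.1.2)),
      fun _ => rfl, fun _ => rfl⟩ : V × (V × V) × (V × V) ≃ V × (V × V) × (V × V)) _ _ (fun _ => rfl)
  have e12 : ∑ q : V × (V × V) × (V × V), F q.2.2.2 q.1 q.2.1.1 q.2.1.2 q.2.2.1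
      = ∑ q : V × (V × V) × (V × V), F q.1 q.2.1.1 q.2.1.2 q.2.2.1 q.2.2.2 :=
    Fintype.sum_equiv (⟨fun q => (q.2.2.2, (q.1, q.2.1.1), (q.2.1.2, q.2.2.1)),
      fun q => (q.2.1.1, (q.2.1.2, q.2.2.1), (q.2.2.2, q.1)),
      fun _ => rfl, fun _ => rfl⟩ : V × (V × V) × (V × V) ≃ V × (V × V) × (V × V)) _ _ (fun _ => rfl)
  have e13 : ∑ q : V × (V × V) × (V × V), F q.2.2.2 q.1 q.2.1.2 q.2.1.1 q.2.2.1
      = ∑ q : V × (V × V) × (V × V), F q.1 q.2.1.1 q.2.1.2 q.2.2.1 q.2.2.2 :=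
    Fintype.sum_equiv (⟨fun q => (q.2.2.2, (q.1, q.2.1.2), (q.2.1.1, q.2.2.1)),
      fun q => (q.2.1.1, (q.2.2.1, q.2.1.2), (q.2.2.2, q.1)),
      fun _ => rfl, fun _ => rfl⟩ : V × (V × V) × (V × V) ≃ V × (V × V) × (V × V)) _ _ (fun _ => rfl)
  have e14 : ∑ q : V × (V × V) × (V × V), F q.2.2.2 q.1 q.2.2.1 q.2.1.1 q.2.1.2
      = ∑ q : V × (V × V) × (V × V), F q.1 q.2.1.1 q.2.1.2 q.2.2.1 q.2.2.2 :=
    Fintype.sum_equiv (⟨fun q => (q.2.2.2, (q.1, q.2.2.1), (q.2.1.1, q.2.1.2)),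
      fun q => (q.2.1.1, (q.2.2.1, q.2.2.2), (q.2.1.2, q.1)),
      fun _ => rfl, fun _ => rfl⟩ : V × (V × V) × (V × V) ≃ V × (V × V) × (V × V)) _ _ (fun _ => rfl)
  have key := Finset.sum_nonneg (s := (Finset.univ : Finset (V × (V × V) × (V × V))))
    (fun q _ => hF q.1 q.2.1.1 q.2.1.2 q.2.2.1 q.2.2.2)
  simp only [Finset.sum_add_distrib, e1, e2, e3, e4, e5, e6, e7, e8, e9, e10, e11, e12, e13, e14] at key
  linarith

theorem S_nonneg {V : Type*} [Fintype V] (A : V → V → Bool) (hs : ∀ x y, A x y = A y x) :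
    0 ≤ ∑ q : V × (V × V) × (V × V), KF A q.1 q.2.1.1 q.2.1.2 q.2.2.1 q.2.2.2 := by
  refine sum_perm_nonneg (KF A) ?_
  intro a b c d e
  have := K5_sum (A a b) (A a c) (A a d) (A a e) (A b c) (A b d) (A b e) (A c d) (A c e) (A d e)
  simp only [KF, hs b a, hs c a, hs d a, hs e a, hs c b, hs d b, hs e b, hs d c, hs e c, hs e d]
  exact this

theorem prod_expand {W : Type*} [Fintype W] (H G L M : W → ℤ) :
    ∑ q : W × W, (9 - 8 * H q.1 - 8 * H q.2 + 12 * (G q.1 * G q.2) - L q.1 * L q.2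
      - 5 * (M q.1 * M q.2))
    = 9 * (Fintype.card W : ℤ) ^ 2 - 16 * Fintype.card W * ∑ p, H p + 12 * (∑ p, G p) ^ 2
      - (∑ p, L p) ^ 2 - 5 * (∑ p, M p) ^ 2 := by
  rw [Fintype.sum_prod_type]
  simp only [Finset.sum_add_distrib, Finset.sum_sub_distrib, ← Finset.mul_sum, ← Finset.sum_mul,
    Finset.sum_const, Finset.card_univ, nsmul_eq_mul]
  ring

theorem graph_ineq {V : Type*} [Fintype V] (A : V → V → Bool) (hs : ∀ x y, A x y = A y x) :
    16 * (Fintype.card V : ℤ) ^ 2 * ∑ v, ∑ p : V × V, h3 (A v p.1) (A v p.2) (A p.1 p.2)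
    ≤ 9 * (Fintype.card V : ℤ) ^ 5
      + 12 * Fintype.card V * (∑ p : V × V, bi (A p.1 p.2)) ^ 2 := by
  have h := S_nonneg A hs
  rw [Fintype.sum_prod_type] at h
  have h2 : ∀ v : V, ∑ q : (V × V) × (V × V), KF A v q.1.1 q.1.2 q.2.1 q.2.2
      ≤ 9 * (Fintype.card V : ℤ) ^ 4
        - 16 * (Fintype.card V : ℤ) ^ 2 * ∑ p : V × V, h3 (A v p.1) (A v p.2) (A p.1 p.2)
        + 12 * (∑ p : V × V, bi (A p.1 p.2)) ^ 2 := by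
    intro v
    have e := prod_expand (W := V × V) (fun p => h3 (A v p.1) (A v p.2) (A p.1 p.2))
      (fun p => bi (A p.1 p.2)) (fun p => l1 (A v p.1) (A v p.2) (A p.1 p.2))
      (fun p => l2 (A v p.1) (A v p.2) (A p.1 p.2))
    simp only [KF, K5]
    rw [e, Fintype.card_prod]
    push_cast
    nlinarith [sq_nonneg (∑ p : V × V, l1 (A v p.1) (A v p.2) (A p.1 p.2)),
      sq_nonneg (∑ p : V × V, l2 (A v p.1) (A v p.2) (A p.1 p.2))]
  have h3' := h.trans (Finset.sum_le_sum fun v _ => h2 v)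
  simp only [Finset.sum_add_distrib, Finset.sum_sub_distrib, ← Finset.mul_sum,
    Finset.sum_const, Finset.card_univ, nsmul_eq_mul] at h3'
  nlinarith [h3']

open Classical in
theorem pointwise {V : Type*} (E : V → V → Prop) (hE : IsOrgraph E) (u v w : V) :
    (if FDFedge E u v w then (0 : ℤ) else 1) ≤
      h3 (decide (E u v ∨ E v u)) (decide (E u w ∨ E w u)) (decide (E v w ∨ E w v))
      - bi (decide (E u v)) * bi (decide (E u w))
      - bi (decide (E v u)) * bi (decide (E v w))
      - bi (decide (E w u)) * bi (decide (E w v)) := by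
  have h1 := hE.2 u v
  have h2 := hE.2 u w
  have h4 := hE.2 v w
  unfold FDFedge
  by_cases a : E u v <;> by_cases b : E v u <;> by_cases c : E u w <;> by_cases d : E w u <;>
    by_cases e : E v w <;> by_cases f : E w v <;> simp_all [h3, bi]

open Classical in
theorem NF_bound {V : Type*} [Fintype V] [Nonempty V] (E : V → V → Prop) (hE : IsOrgraph E) :
    16 * ∑ q : V × V × V, (if FDFedge E q.1 q.2.1 q.2.2 then (0 : ℤ) else 1)
      ≤ 9 * (Fintype.card V : ℤ) ^ 3 := by
  set A : V → V → Bool := fun x y => decide (E x y ∨ E y x) with hA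
  have hs : ∀ x y, A x y = A y x := by intro x y; simp only [hA, or_comm]
  have g := graph_ineq A hs
  set n : ℤ := (Fintype.card V : ℤ) with hn
  have hnpos : 0 < n := by
    rw [hn]; exact_mod_cast Fintype.card_pos
  set out : V → ℤ := fun x => ∑ y, bi (decide (E x y)) with hout
  set P := ∑ v, ∑ p : V × V, h3 (A v p.1) (A v p.2) (A p.1 p.2) with hP
  have s0 : ∀ v, ∑ x, ∑ y, bi (decide (E v x)) * bi (decide (E v y)) = out v ^ 2 := by
    intro v
    simp only [hout, sq, Finset.sum_mul_sum]
  have hM : ∑ p : V × V, bi (A p.1 p.2) = 2 * ∑ v, out v := by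
    have : ∀ x y, bi (A x y) = bi (decide (E x y)) + bi (decide (E y x)) := by
      intro x y
      have := hE.2 x y
      by_cases a : E x y <;> by_cases b : E y x <;> simp_all [bi]
    rw [Fintype.sum_prod_type]
    simp only [this, Finset.sum_add_distrib]
    rw [two_mul]
    congr 1
    rw [Finset.sum_comm]
  have cs : (∑ v, out v) ^ 2 ≤ n * ∑ v, out v ^ 2 := by
    have := sq_sum_le_card_mul_sum_sq (s := (Finset.univ : Finset V)) (f := out)
    simpa [hn] using this
  have hNF : ∑ q : V × V × V, (if FDFedge E q.1 q.2.1 q.2.2 then (0 : ℤ) else 1)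
      ≤ P - 3 * ∑ v, out v ^ 2 := by
    refine (Finset.sum_le_sum fun q _ => pointwise E hE q.1 q.2.1 q.2.2).trans (le_of_eq ?_)
    simp only [Finset.sum_sub_distrib]
    have e1 : ∑ q : V × V × V, bi (decide (E q.1 q.2.1)) * bi (decide (E q.1 q.2.2))
        = ∑ v, out v ^ 2 := by
      simp only [Fintype.sum_prod_type, s0]
    have e2 : ∑ q : V × V × V, bi (decide (E q.2.1 q.1)) * bi (decide (E q.2.1 q.2.2))
        = ∑ v, out v ^ 2 := by
      rw [← e1]
      exact Fintype.sum_equiv ⟨fun q => (q.2.1, q.1, q.2.2), fun q => (q.2.1, q.1, q.2.2),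
        fun _ => rfl, fun _ => rfl⟩ _ _ (fun _ => rfl)
    have e3 : ∑ q : V × V × V, bi (decide (E q.2.2 q.1)) * bi (decide (E q.2.2 q.2.1))
        = ∑ v, out v ^ 2 := by
      rw [← e1]
      exact Fintype.sum_equiv ⟨fun q => (q.2.2, q.1, q.2.1), fun q => (q.2.1, q.2.2, q.1),
        fun _ => rfl, fun _ => rfl⟩ _ _ (fun _ => rfl)
    rw [e1, e2, e3, Fintype.sum_prod_type]
    simp only [hP, hA]
    ring
  rw [hM] at g
  set NF := ∑ q : V × V × V, (if FDFedge E q.1 q.2.1 q.2.2 then (0 : ℤ) else 1)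
  set Q := ∑ v, out v ^ 2
  have k1 : 16 * n ^ 2 * NF ≤ 9 * n ^ 5 := by
    have k2 : 16 * n ^ 2 * NF ≤ 16 * n ^ 2 * (P - 3 * Q) :=
      mul_le_mul_of_nonneg_left hNF (by positivity)
    have k3 : 48 * n * (∑ v, out v) ^ 2 ≤ 48 * n * (n * Q) :=
      mul_le_mul_of_nonneg_left cs (by positivity)
    nlinarith
  have : n ^ 2 * (16 * NF) ≤ n ^ 2 * (9 * n ^ 3) := by nlinarith
  exact le_of_mul_le_mul_left this (by positivity)

open Classical in
theorem count_bound {V : Type*} [Fintype V] (E : V → V → Prop) :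
    (((Finset.univ : Finset (V × V × V)).filter fun q =>
      (q.1 ≠ q.2.1 ∧ q.1 ≠ q.2.2 ∧ q.2.1 ≠ q.2.2) ∧ FDFedge E q.1 q.2.1 q.2.2).card)
      ≤ 6 * fdfCount V E := by
  unfold fdfCount
  refine Finset.card_le_mul_card_image_of_maps_to
    (f := fun q : V × V × V => ({q.1, q.2.1, q.2.2} : Finset V)) ?_ 6 ?_
  · rintro ⟨u, v, w⟩ h
    simp only [Finset.mem_filter, Finset.mem_univ, true_and] at h
    obtain ⟨⟨h1, h2, h3⟩, h4⟩ := h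
    simp only [Finset.mem_filter, Finset.mem_powersetCard, Finset.subset_univ, true_and]
    exact ⟨Finset.card_eq_three.2 ⟨u, v, w, h1, h2, h3, rfl⟩, u, v, w, h1, h2, h3, rfl, h4⟩
  · intro s hs
    simp only [Finset.mem_filter] at hs
    obtain ⟨-, a, b, c, hab, hac, hbc, rfl, -⟩ := hs
    refine (Finset.card_le_card (t := {(a, b, c), (a, c, b), (b, a, c), (b, c, a), (c, a, b),
      (c, b, a)}) ?_).trans Finset.card_le_six
    rintro ⟨u, v, w⟩ h
    simp only [Finset.mem_filter, Finset.mem_univ, true_and] at h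
    obtain ⟨⟨⟨h1, h2, h3⟩, -⟩, h5⟩ := h
    have hu : u ∈ ({a, b, c} : Finset V) := by rw [← h5]; simp
    have hv : v ∈ ({a, b, c} : Finset V) := by rw [← h5]; simp
    have hw : w ∈ ({a, b, c} : Finset V) := by rw [← h5]; simp
    simp only [Finset.mem_insert, Finset.mem_singleton] at hu hv hw
    simp only [Finset.mem_insert, Finset.mem_singleton, Prod.mk.injEq]
    clear h5
    rcases hu with rfl | rfl | rfl <;> rcases hv with rfl | rfl | rfl <;>
      rcases hw with rfl | rfl | rfl <;> simp_all

open Classical in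
theorem total_bound (n : ℕ) (hn : 0 < n) (E : Fin n → Fin n → Prop) (hE : IsOrgraph E) :
    7 * (n : ℤ) ^ 3 ≤ 96 * (fdfCount (Fin n) E : ℤ) + 48 * (n : ℤ) ^ 2 := by
  have : Nonempty (Fin n) := ⟨⟨0, hn⟩⟩
  have h1 := NF_bound E hE
  have h2 := count_bound E
  have h2' : ∑ q : Fin n × Fin n × Fin n, (if (q.1 ≠ q.2.1 ∧ q.1 ≠ q.2.2 ∧ q.2.1 ≠ q.2.2) ∧
      FDFedge E q.1 q.2.1 q.2.2 then (1 : ℤ) else 0) ≤ 6 * (fdfCount (Fin n) E : ℤ) := by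
    rw [Finset.sum_boole]
    exact_mod_cast h2
  have d2 : ∑ q : Fin n × Fin n × Fin n, (if q.1 = q.2.2 then (1 : ℤ) else 0) = (n : ℤ) ^ 2 := by
    simp only [Fintype.sum_prod_type]
    simp [sq]
  have d1 : ∑ q : Fin n × Fin n × Fin n, (if q.1 = q.2.1 then (1 : ℤ) else 0) = (n : ℤ) ^ 2 := by
    rw [← d2]
    exact Fintype.sum_equiv ⟨fun q => (q.1, q.2.2, q.2.1), fun q => (q.1, q.2.2, q.2.1),
      fun _ => rfl, fun _ => rfl⟩ _ _ (fun _ => rfl)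
  have d3 : ∑ q : Fin n × Fin n × Fin n, (if q.2.1 = q.2.2 then (1 : ℤ) else 0)
      = (n : ℤ) ^ 2 := by
    simp only [Fintype.sum_prod_type]
    simp [sq]
  have tot : ∑ q : Fin n × Fin n × Fin n, (1 : ℤ) = (n : ℤ) ^ 3 := by
    simp [Fintype.card_prod]
    ring
  have key : ∑ q : Fin n × Fin n × Fin n, (1 : ℤ) ≤ ∑ q : Fin n × Fin n × Fin n,
      ((if (q.1 ≠ q.2.1 ∧ q.1 ≠ q.2.2 ∧ q.2.1 ≠ q.2.2) ∧
        FDFedge E q.1 q.2.1 q.2.2 then (1 : ℤ) else 0)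
      + (if FDFedge E q.1 q.2.1 q.2.2 then (0 : ℤ) else 1)
      + (if q.1 = q.2.1 then (1 : ℤ) else 0) + (if q.1 = q.2.2 then (1 : ℤ) else 0)
      + (if q.2.1 = q.2.2 then (1 : ℤ) else 0)) := by
    refine Finset.sum_le_sum fun q _ => ?_
    split_ifs <;> first | omega | tauto
  simp only [Finset.sum_add_distrib] at key
  rw [tot, d1, d2, d3] at key
  rw [Fintype.card_fin] at h1
  linarith

/-- Every orgraph (not necessarily C⃗₄-free) on n ≥ N vertices has at least
(7/16 − ε)·C(n,3) edges in FDF(Γ). -/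
theorem stmt3 :
    ∀ ε : ℝ, ε > 0 → ∃ N : ℕ, ∀ n : ℕ, N ≤ n → ∀ E : Fin n → Fin n → Prop,
      IsOrgraph E →
      ((7 : ℝ) / 16 - ε) * (n.choose 3 : ℝ) ≤ (fdfCount (Fin n) E : ℝ) := by
  intro ε hε
  refine ⟨max 4 ⌈12 / ε⌉₊, fun n hn E hE => ?_⟩
  have hn4 : 4 ≤ n := (le_max_left _ _).trans hn
  have hnε : 12 / ε ≤ (n : ℝ) := (Nat.le_ceil _).trans (by exact_mod_cast (le_max_right _ _).trans hn)
  have hx : 12 ≤ ε * n := by rwa [div_le_iff₀' hε] at hnε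
  have hx4 : (4 : ℝ) ≤ n := by exact_mod_cast hn4
  have t := total_bound n (by omega) E hE
  have t' : 7 * (n : ℝ) ^ 3 ≤ 96 * (fdfCount (Fin n) E : ℝ) + 48 * (n : ℝ) ^ 2 := by
    exact_mod_cast t
  have hc : 6 * (n.choose 3 : ℝ) = n * (n - 1) * (n - 2) := by
    obtain ⟨m, rfl⟩ : ∃ m, n = m + 3 := ⟨n - 3, by omega⟩
    have := Nat.descFactorial_eq_factorial_mul_choose (m + 3) 3
    simp [Nat.descFactorial, Nat.factorial] at this
    have h' : ((m + 1) * ((m + 2) * (m + 3)) : ℝ) = 6 * ((m + 3).choose 3 : ℝ) := by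
      exact_mod_cast this
    push_cast
    linarith
  set x : ℝ := (n : ℝ) with hxdef
  set D : ℝ := x * (x - 1) * (x - 2)
  have hD1 : D ≤ x ^ 3 := by simp only [D]; nlinarith
  have hD2 : x ^ 3 / 4 ≤ D := by
    have : 0 ≤ x * (3 / 4 * x ^ 2 - 3 * x + 2) := mul_nonneg (by linarith) (by nlinarith)
    simp only [D]; nlinarith
  have h3 : 3 * x ^ 2 ≤ ε * D := by
    have h4 : ε * (x ^ 3 / 4) ≤ ε * D := mul_le_mul_of_nonneg_left hD2 hε.le
    have h5 : 12 * x ^ 2 ≤ ε * x * x ^ 2 := mul_le_mul_of_nonneg_right hx (by positivity)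
    nlinarith
  have e : (7 / 16 - ε) * (n.choose 3 : ℝ) = (7 / 16 * D - ε * D) / 6 := by rw [← hc]; ring
  rw [e]
  linarith
end

section
/- For every ε > 0 there exists N such that for every n ≥ N, every C⃗4-free orgraph Γ on n vertices satisfies: the number of edges of FDF(Γ) is at least (3/7 − ε)·C(n,3). -/
open Finset

/-! The proof is a flag-algebra (Cauchy–Schwarz) argument on four vertices.  The relation between two
vertices `x, y` is coded by `0` (no edge), `1` (`x → y`), `2` (`y → x`). -/

/-- Code of the reversed pair. -/
def pinv : Fin 3 → Fin 3
  | 0 => 0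
  | 1 => 2
  | 2 => 1

/-- Coefficient vectors used over an edge `x → y`, indexed by `3 * code (x,z) + code (y,z)`. -/
def vecE : List (List ℤ) :=
  [[11, -3, -1, 5, 3, 3, -2, -4, -2], [0, 20, -1, -11, 12, -14, -10, 14, -8],
   [0, 0, 6, -11, -12, -14, 6, 7, 9], [0, 0, 0, 6, 7, -1, -7, -3, -5], [0, 0, 0, 0, 0, 1, 0, 0, 0]]

/-- Coefficient vectors used over a non-adjacent pair. -/
def vecN : List (List ℤ) :=
  [[9, 3, 9, 3, -8, -9, 9, -9, 1], [0, 4, -6, 4, 7, -1, -6, -1, -7],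
   [0, 9, -6, 9, 0, 0, -6, 0, 0], [0, 0, 6, 0, 0, 0, 6, 0, 0], []]

/-- The `k`-th coefficient for the triple with codes `a = (x,y)`, `b = (x,z)`, `c = (y,z)`. -/
def coef (k : ℕ) (a b c : Fin 3) : ℤ :=
  match a with
  | 0 => (vecN.getD k []).getD (3 * b.val + c.val) 0
  | 1 => (vecE.getD k []).getD (3 * b.val + c.val) 0
  | 2 => 0

/-- Indicator that a triple with codes `a = (x,y)`, `b = (x,z)`, `c = (y,z)` is an FDF edge. -/
def fd (a b c : Fin 3) : ℤ :=
  if (a = 1 ∧ b = 1) ∨ (a = 2 ∧ c = 1) ∨ (b = 2 ∧ c = 2) ∨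
    (a = 0 ∧ b = 0) ∨ (a = 0 ∧ c = 0) ∨ (b = 0 ∧ c = 0) then 1 else 0

/-- The sum of products of coefficients. -/
def quad (a b c bb cc : Fin 3) : ℤ :=
  coef 0 a b c * coef 0 a bb cc + coef 1 a b c * coef 1 a bb cc + coef 2 a b c * coef 2 a bb cc +
  coef 3 a b c * coef 3 a bb cc + coef 4 a b c * coef 4 a bb cc

/-- The local functional. -/
def gg (a b c bb cc : Fin 3) : ℤ := 72 * (7 * (fd a b c + fd a bb cc) - 6) - 7 * quad a b c bb cc

/-- Sum of the local functional over the twelve choices of the ordered root pair. -/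
def tot (a b c d e f : Fin 3) : ℤ :=
  gg a b d c e + gg (pinv a) d b e c + gg b a (pinv d) c f + gg (pinv b) (pinv d) a f c +
  gg c a (pinv e) b (pinv f) + gg (pinv c) (pinv e) a (pinv f) b +
  gg d (pinv a) (pinv b) e f + gg (pinv d) (pinv b) (pinv a) f e +
  gg e (pinv a) (pinv c) d (pinv f) + gg (pinv e) (pinv c) (pinv a) (pinv f) d +
  gg f (pinv b) (pinv c) (pinv d) (pinv e) + gg (pinv f) (pinv c) (pinv b) (pinv e) (pinv d)

/-- The pattern is the 4-cycle `0 → 1 → 2 → 3 → 0`. -/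
def cyc (a b c d e f : Fin 3) : Prop := a = 1 ∧ d = 1 ∧ f = 1 ∧ c = 2 ∧ b = 0 ∧ e = 0

instance (a b c d e f : Fin 3) : Decidable (cyc a b c d e f) := by unfold cyc; infer_instance

/-- Some labelling of the pattern is a 4-cycle. -/
def isC4 (a b c d e f : Fin 3) : Prop :=
  cyc a b c d e f ∨ cyc a c b e d (pinv f) ∨ cyc b a c (pinv d) f e ∨
  cyc b c a f (pinv d) (pinv e) ∨ cyc c a b (pinv e) (pinv f) d ∨ cyc c b a (pinv f) (pinv e) (pinv d)

instance (a b c d e f : Fin 3) : Decidable (isC4 a b c d e f) := by unfold isC4; infer_instance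

theorem tot_nonneg : ∀ a b c d e f : Fin 3, ¬ isC4 a b c d e f → 0 ≤ tot a b c d e f := by
  decide +kernel

theorem gg_lower : ∀ a b c bb cc : Fin 3, -10000 ≤ gg a b c bb cc := by
  decide +kernel

section main
variable {n : ℕ}

open Classical in
/-- The code of a pair of vertices. -/
noncomputable def cd (E : Fin n → Fin n → Prop) (x y : Fin n) : Fin 3 :=
  if E x y then 1 else if E y x then 2 else 0

theorem cd_pinv {E : Fin n → Fin n → Prop} (hE : IsOrgraph E) (x y : Fin n) :
    cd E y x = pinv (cd E x y) := by
  have := hE.2 x y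
  unfold cd
  by_cases h1 : E x y <;> by_cases h2 : E y x <;> simp_all [pinv]

theorem cd_one {E : Fin n → Fin n → Prop} (x y : Fin n) :
    cd E x y = 1 ↔ E x y := by
  unfold cd
  by_cases h1 : E x y <;> by_cases h2 : E y x <;> simp_all

theorem cd_zero {E : Fin n → Fin n → Prop} (x y : Fin n) :
    cd E x y = 0 ↔ ¬ E x y ∧ ¬ E y x := by
  unfold cd
  by_cases h1 : E x y <;> by_cases h2 : E y x <;> simp_all

theorem cd_two {E : Fin n → Fin n → Prop} (hE : IsOrgraph E) (x y : Fin n) :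
    cd E x y = 2 ↔ E y x := by
  have := hE.2 x y
  unfold cd
  by_cases h1 : E x y <;> by_cases h2 : E y x <;> simp_all

/-- The local functional on vertices. -/
noncomputable def G (E : Fin n → Fin n → Prop) (x y z w : Fin n) : ℤ :=
  gg (cd E x y) (cd E x z) (cd E y z) (cd E x w) (cd E y w)

/-- Sum of `G` over the twelve root choices. -/
noncomputable def G12 (E : Fin n → Fin n → Prop) (x y z w : Fin n) : ℤ :=
  G E x y z w + G E y x z w + G E x z y w + G E z x y w + G E x w y z + G E w x y z +
  G E y z x w + G E z y x w + G E y w x z + G E w y x z + G E z w x y + G E w z x y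

theorem not_cyc {E : Fin n → Fin n → Prop} (hE : IsOrgraph E) (h4 : ¬ HasInducedC4 E)
    {x y z w : Fin n} (h : x ≠ y ∧ x ≠ z ∧ x ≠ w ∧ y ≠ z ∧ y ≠ w ∧ z ≠ w) :
    ¬ cyc (cd E x y) (cd E x z) (cd E x w) (cd E y z) (cd E y w) (cd E z w) := by
  rintro ⟨h1, h2, h3, h5, h6, h7⟩
  rw [cd_one] at h1 h2 h3
  rw [cd_two hE] at h5
  rw [cd_zero] at h6 h7
  obtain ⟨a, b, c, d, e, f⟩ := h
  exact h4 ⟨x, y, z, w, a, b, c, d, e, f, h1, h2, h3, h5, hE.2 _ _ h1, hE.2 _ _ h2, hE.2 _ _ h3,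
    hE.2 _ _ h5, h6.1, h6.2, h7.1, h7.2⟩

theorem G12_nonneg {E : Fin n → Fin n → Prop} (hE : IsOrgraph E) (h4 : ¬ HasInducedC4 E)
    {x y z w : Fin n} (h : x ≠ y ∧ x ≠ z ∧ x ≠ w ∧ y ≠ z ∧ y ≠ w ∧ z ≠ w) :
    0 ≤ G12 E x y z w := by
  have key := tot_nonneg (cd E x y) (cd E x z) (cd E x w) (cd E y z) (cd E y w) (cd E z w) ?_
  · simp only [tot, ← cd_pinv hE] at key
    simpa only [G12, G] using key
  · obtain ⟨a, b, c, d, e, f⟩ := h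
    simp only [isC4, ← cd_pinv hE]
    rintro (h | h | h | h | h | h)
    · exact not_cyc hE h4 ⟨a, b, c, d, e, f⟩ h
    · exact not_cyc hE h4 ⟨a, c, b, e, d, f.symm⟩ h
    · exact not_cyc hE h4 ⟨b, a, c, d.symm, f, e⟩ h
    · exact not_cyc hE h4 ⟨b, c, a, f, d.symm, e.symm⟩ h
    · exact not_cyc hE h4 ⟨c, a, b, e.symm, f.symm, d⟩ h
    · exact not_cyc hE h4 ⟨c, b, a, f.symm, e.symm, d.symm⟩ h

/-- Indicator of equality. -/
def dl (x y : Fin n) : ℤ := if x = y then 1 else 0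

theorem dl_nonneg (x y : Fin n) : 0 ≤ dl x y := by unfold dl; split_ifs <;> simp

theorem G12_lower {E : Fin n → Fin n → Prop} (hE : IsOrgraph E) (h4 : ¬ HasInducedC4 E)
    (x y z w : Fin n) :
    -120000 * (dl x y + dl x z + dl x w + dl y z + dl y w + dl z w) ≤ G12 E x y z w := by
  have p1 := dl_nonneg x y
  have p2 := dl_nonneg x z
  have p3 := dl_nonneg x w
  have p4 := dl_nonneg y z
  have p5 := dl_nonneg y w
  have p6 := dl_nonneg z w
  by_cases h : x ≠ y ∧ x ≠ z ∧ x ≠ w ∧ y ≠ z ∧ y ≠ w ∧ z ≠ w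
  · have := G12_nonneg hE h4 h
    linarith
  · have h1 : 1 ≤ dl x y + dl x z + dl x w + dl y z + dl y w + dl z w := by
      by_contra hc
      apply h
      refine ⟨?_, ?_, ?_, ?_, ?_, ?_⟩ <;>
      · intro he
        have : ∀ u : Fin n, dl u u = 1 := fun u => by simp [dl]
        have := this w
        have := ‹∀ u : Fin n, dl u u = 1› z
        have := ‹∀ u : Fin n, dl u u = 1› y
        subst he
        linarith
    have b : ∀ x y z w : Fin n, -10000 ≤ G E x y z w := fun x y z w => gg_lower _ _ _ _ _
    unfold G12
    linarith [b x y z w, b y x z w, b x z y w, b z x y w, b x w y z, b w x y z,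
      b y z x w, b z y x w, b y w x z, b w y x z, b z w x y, b w z x y]

/-- Sum over all quadruples. -/
def S4 (h : Fin n → Fin n → Fin n → Fin n → ℤ) : ℤ := ∑ x, ∑ y, ∑ z, ∑ w, h x y z w

theorem S4_12 (h : Fin n → Fin n → Fin n → Fin n → ℤ) :
    S4 (fun x y z w => h y x z w) = S4 h := Finset.sum_comm

theorem S4_23 (h : Fin n → Fin n → Fin n → Fin n → ℤ) :
    S4 (fun x y z w => h x z y w) = S4 h :=
  Finset.sum_congr rfl fun _ _ => Finset.sum_comm

theorem S4_34 (h : Fin n → Fin n → Fin n → Fin n → ℤ) :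
    S4 (fun x y z w => h x y w z) = S4 h :=
  Finset.sum_congr rfl fun _ _ => Finset.sum_congr rfl fun _ _ => Finset.sum_comm

theorem S4_add (h k : Fin n → Fin n → Fin n → Fin n → ℤ) :
    S4 (fun x y z w => h x y z w + k x y z w) = S4 h + S4 k := by
  simp only [S4, Finset.sum_add_distrib]

theorem S4_G12 (E : Fin n → Fin n → Prop) : S4 (G12 E) = 12 * S4 (G E) := by
  set g := G E with hg
  have e1 : S4 (fun x y z w => g y x z w) = S4 g := S4_12 g
  have e2 : S4 (fun x y z w => g x z y w) = S4 g := S4_23 g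
  have e3 : S4 (fun x y z w => g z x y w) = S4 g := by
    rw [← e1]; exact S4_23 (fun x y z w => g y x z w)
  have e4 : S4 (fun x y z w => g x w y z) = S4 g := by
    rw [← e2]; exact S4_34 (fun x y z w => g x z y w)
  have e5 : S4 (fun x y z w => g w x y z) = S4 g := by
    rw [← e3]; exact S4_34 (fun x y z w => g z x y w)
  have e6 : S4 (fun x y z w => g y z x w) = S4 g := by
    rw [← e2]; exact S4_12 (fun x y z w => g x z y w)
  have e7 : S4 (fun x y z w => g z y x w) = S4 g := by
    rw [← e3]; exact S4_12 (fun x y z w => g z x y w)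
  have e8 : S4 (fun x y z w => g y w x z) = S4 g := by
    rw [← e4]; exact S4_12 (fun x y z w => g x w y z)
  have e9 : S4 (fun x y z w => g w y x z) = S4 g := by
    rw [← e5]; exact S4_12 (fun x y z w => g w x y z)
  have e10 : S4 (fun x y z w => g z w x y) = S4 g := by
    rw [← e8]; exact S4_23 (fun x y z w => g y w x z)
  have e11 : S4 (fun x y z w => g w z x y) = S4 g := by
    rw [← e9]; exact S4_23 (fun x y z w => g w y x z)
  have : G12 E = fun x y z w => g x y z w + g y x z w + g x z y w + g z x y w + g x w y z +
      g w x y z + g y z x w + g z y x w + g y w x z + g w y x z + g z w x y + g w z x y := rfl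
  rw [this]
  simp only [S4_add, e1, e2, e3, e4, e5, e6, e7, e8, e9, e10, e11]
  have : S4 (fun x y z w => g x y z w) = S4 g := rfl
  rw [this]; ring

theorem S4_lower {E : Fin n → Fin n → Prop} (hE : IsOrgraph E) (h4 : ¬ HasInducedC4 E) :
    -60000 * (n : ℤ) ^ 3 ≤ S4 (G E) := by
  have h1 : S4 (fun x y z w : Fin n =>
      -120000 * (dl x y + dl x z + dl x w + dl y z + dl y w + dl z w)) ≤ S4 (G12 E) := by
    unfold S4
    gcongr
    exact G12_lower hE h4 _ _ _ _
  have h2 : S4 (fun x y z w : Fin n =>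
      -120000 * (dl x y + dl x z + dl x w + dl y z + dl y w + dl z w)) =
      -720000 * (n : ℤ) ^ 3 := by
    simp only [S4, ← Finset.mul_sum, Finset.sum_add_distrib, dl, Finset.sum_ite_eq,
      Finset.sum_const, Finset.card_univ, Fintype.card_fin, nsmul_eq_mul, Finset.mem_univ, if_true]
    ring
  rw [S4_G12] at h1
  linarith

/-- Ordered count of FDF triples. -/
noncomputable def T3 (E : Fin n → Fin n → Prop) : ℤ :=
  ∑ x, ∑ y, ∑ z, fd (cd E x y) (cd E x z) (cd E y z)

theorem S4_upper (E : Fin n → Fin n → Prop) :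
    S4 (G E) ≤ 144 * n * (7 * T3 E - 3 * (n : ℤ) ^ 3) := by
  have h1 : S4 (G E) = 144 * n * (7 * T3 E - 3 * (n : ℤ) ^ 3) -
      7 * S4 (fun x y z w => quad (cd E x y) (cd E x z) (cd E y z) (cd E x w) (cd E y w)) := by
    simp only [S4, G, gg, T3, Finset.sum_sub_distrib, Finset.sum_add_distrib, ← Finset.mul_sum,
      Finset.sum_const, Finset.card_univ, Fintype.card_fin, nsmul_eq_mul]
    ring
  have h2 : 0 ≤ S4 (fun x y z w => quad (cd E x y) (cd E x z) (cd E y z) (cd E x w) (cd E y w)) := by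
    unfold S4
    refine Finset.sum_nonneg fun x _ => Finset.sum_nonneg fun y _ => ?_
    simp only [quad, Finset.sum_add_distrib, ← Finset.mul_sum, ← Finset.sum_mul]
    have := fun k => mul_self_nonneg (∑ z, coef k (cd E x y) (cd E x z) (cd E y z))
    linarith [this 0, this 1, this 2, this 3, this 4]
  linarith

theorem T3_lower {E : Fin n → Fin n → Prop} (hE : IsOrgraph E) (h4 : ¬ HasInducedC4 E) :
    3 * (n : ℤ) ^ 3 - 500 * (n : ℤ) ^ 2 ≤ 7 * T3 E := by
  rcases Nat.eq_zero_or_pos n with rfl | hn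
  · simp [T3]
  have h1 := S4_lower hE h4
  have h2 := S4_upper E
  have hnpos : (0 : ℤ) < n := by exact_mod_cast hn
  by_contra hc
  push Not at hc
  have h3 : 144 * (n : ℤ) * (7 * T3 E - 3 * (n : ℤ) ^ 3) ≤ 144 * n * (-500 * (n : ℤ) ^ 2) := by
    apply mul_le_mul_of_nonneg_left _ (by positivity)
    linarith
  have h5 : (0 : ℤ) < (n : ℤ) ^ 3 := by positivity
  nlinarith

theorem fd_iff {E : Fin n → Fin n → Prop} (hE : IsOrgraph E) (x y z : Fin n)
    (h : fd (cd E x y) (cd E x z) (cd E y z) ≠ 0) : FDFedge E x y z := by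
  unfold fd at h
  split_ifs at h with hfd
  · simp only [cd_one, cd_two hE, cd_zero] at hfd
    unfold FDFedge
    tauto
  · simp at h

open Classical in
theorem ordered_le {E : Fin n → Fin n → Prop} :
    ((Finset.univ : Finset (Fin n × Fin n × Fin n)).filter (fun t =>
      t.1 ≠ t.2.1 ∧ t.1 ≠ t.2.2 ∧ t.2.1 ≠ t.2.2 ∧ FDFedge E t.1 t.2.1 t.2.2)).card ≤
      6 * fdfCount (Fin n) E := by
  unfold fdfCount
  apply Finset.card_le_mul_card_image_of_maps_to
    (f := fun t : Fin n × Fin n × Fin n => ({t.1, t.2.1, t.2.2} : Finset (Fin n)))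
  · rintro ⟨x, y, z⟩ ht
    simp only [Finset.mem_univ, true_and, Finset.mem_filter,
      Finset.mem_powersetCard, Finset.subset_univ] at ht ⊢
    obtain ⟨h1, h2, h3, h⟩ := ht
    exact ⟨Finset.card_eq_three.2 ⟨x, y, z, h1, h2, h3, by ext; simp⟩, x, y, z, h1, h2, h3, by ext; simp, h⟩
  · intro s hs
    simp only [Finset.mem_filter] at hs
    obtain ⟨-, a, b, c, hab, hac, hbc, rfl, -⟩ := hs
    refine le_trans (Finset.card_le_card (t := {(a, b, c), (a, c, b), (b, a, c), (b, c, a),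
      (c, a, b), (c, b, a)}) ?_) Finset.card_le_six
    rintro ⟨x, y, z⟩ ht
    simp only [Finset.mem_filter, Finset.mem_univ, true_and] at ht
    obtain ⟨⟨h1, h2, h3, -⟩, h⟩ := ht
    have hx : x = a ∨ x = b ∨ x = c := by simpa using Finset.ext_iff.1 h x
    have hy : y = a ∨ y = b ∨ y = c := by simpa using Finset.ext_iff.1 h y
    have hz : z = a ∨ z = b ∨ z = c := by simpa using Finset.ext_iff.1 h z
    clear h
    rcases hx with rfl | rfl | rfl <;> rcases hy with rfl | rfl | rfl <;>
      rcases hz with rfl | rfl | rfl <;> simp_all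

theorem T3_upper {E : Fin n → Fin n → Prop} (hE : IsOrgraph E) :
    T3 E ≤ 6 * (fdfCount (Fin n) E : ℤ) + 3 * (n : ℤ) ^ 2 := by
  classical
  have h1 : T3 E ≤ ∑ x, ∑ y, ∑ z, ((if (x ≠ y ∧ x ≠ z ∧ y ≠ z ∧ FDFedge E x y z) then (1 : ℤ) else 0)
      + (dl x y + dl x z + dl y z)) := by
    unfold T3
    gcongr with x _ y _ z _
    have q1 := dl_nonneg x y
    have q2 := dl_nonneg x z
    have q3 := dl_nonneg y z
    have f1 : fd (cd E x y) (cd E x z) (cd E y z) ≤ 1 := by unfold fd; split_ifs <;> simp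
    by_cases h0 : fd (cd E x y) (cd E x z) (cd E y z) = 0
    · rw [h0]; split_ifs <;> linarith
    · have := fd_iff hE x y z h0
      by_cases e1 : x = y
      · have : dl x y = 1 := by simp [dl, e1]
        split_ifs <;> linarith
      by_cases e2 : x = z
      · have : dl x z = 1 := by simp [dl, e2]
        split_ifs <;> linarith
      by_cases e3 : y = z
      · have : dl y z = 1 := by simp [dl, e3]
        split_ifs <;> linarith
      rw [if_pos ⟨e1, e2, e3, this⟩]
      linarith
  have h2 : ∑ x : Fin n, ∑ y : Fin n, ∑ z : Fin n, (dl x y + dl x z + dl y z) = 3 * (n : ℤ) ^ 2 := by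
    simp only [Finset.sum_add_distrib, dl, Finset.sum_ite_eq, ← Finset.mul_sum,
      Finset.sum_const, Finset.card_univ, Fintype.card_fin, nsmul_eq_mul, Finset.mem_univ, if_true]
    ring
  have h3 : ∑ x, ∑ y, ∑ z, (if (x ≠ y ∧ x ≠ z ∧ y ≠ z ∧ FDFedge E x y z) then (1 : ℤ) else 0) ≤
      6 * (fdfCount (Fin n) E : ℤ) := by
    have := ordered_le (E := E)
    rw [Finset.card_filter] at this
    simp only [Fintype.sum_prod_type] at this
    exact_mod_cast this
  simp only [Finset.sum_add_distrib] at h1 h2 h3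
  linarith

end main

/-- Every C⃗₄-free orgraph on n ≥ N vertices has at least (3/7 − ε)·C(n,3)
edges in FDF(Γ). -/
theorem stmt4 :
    ∀ ε : ℝ, ε > 0 → ∃ N : ℕ, ∀ n : ℕ, N ≤ n → ∀ E : Fin n → Fin n → Prop,
      IsOrgraph E → ¬ HasInducedC4 E →
      ((3 : ℝ) / 7 - ε) * (n.choose 3 : ℝ) ≤ (fdfCount (Fin n) E : ℝ) := by
  intro ε hε
  obtain ⟨N, hN⟩ := exists_nat_ge (100 / ε)
  refine ⟨N, fun n hn E hE h4 => ?_⟩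
  have h1 := T3_lower hE h4
  have h2 := T3_upper hE
  have h3 : 3 * (n : ℤ) ^ 3 - 521 * (n : ℤ) ^ 2 ≤ 42 * (fdfCount (Fin n) E : ℤ) := by linarith
  have h3r : 3 * (n : ℝ) ^ 3 - 521 * (n : ℝ) ^ 2 ≤ 42 * (fdfCount (Fin n) E : ℝ) := by
    exact_mod_cast h3
  rcases le_total (3 / 7) ε with h | h
  · have : ((3 : ℝ) / 7 - ε) * (n.choose 3 : ℝ) ≤ 0 :=
      mul_nonpos_of_nonpos_of_nonneg (by linarith) (by positivity)
    exact this.trans (by positivity)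
  · have hc : (n.choose 3 : ℝ) ≤ (n : ℝ) ^ 3 / 6 := by
      have := Nat.choose_le_pow_div (α := ℝ) 3 n
      simpa [Nat.factorial] using this
    have hεn : 100 ≤ ε * n := by
      have : 100 / ε ≤ (n : ℝ) := hN.trans (by exact_mod_cast hn)
      rw [div_le_iff₀ hε] at this
      linarith
    have h5 : ((3 : ℝ) / 7 - ε) * (n.choose 3 : ℝ) ≤ (3 / 7 - ε) * ((n : ℝ) ^ 3 / 6) :=
      mul_le_mul_of_nonneg_left hc (by linarith)
    have h6 : 100 * (n : ℝ) ^ 2 ≤ ε * n * (n : ℝ) ^ 2 :=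
      mul_le_mul_of_nonneg_right hεn (by positivity)
    have h7 : (3 / 7 - ε) * ((n : ℝ) ^ 3 / 6) = (3 * (n : ℝ) ^ 3 - 7 * (ε * n * (n : ℝ) ^ 2)) / 42 := by
      ring
    have h8 : 0 ≤ (n : ℝ) ^ 2 := by positivity
    linarith
end

section
/- If Γ is a C⃗4-free orgraph, then the 3-uniform hypergraph FDF(Γ) is Turán, i.e., every 4 distinct vertices of Γ contain at least one 3-element subset that is an edge of FDF(Γ). -/
open Finset

/-- If Γ is a C⃗₄-free orgraph, then FDF(Γ) is Turán: every 4 distinct vertices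
contain a triple spanning an edge of FDF(Γ). -/
theorem stmt5 {V : Type*} (E : V → V → Prop)
    (hor : IsOrgraph E) (hC4 : ¬ HasInducedC4 E) :
    ∀ a b c d : V, a ≠ b → a ≠ c → a ≠ d → b ≠ c → b ≠ d → c ≠ d →
      FDFedge E a b c ∨ FDFedge E a b d ∨ FDFedge E a c d ∨ FDFedge E b c d := by
  intro a b c d hab hac had hbc hbd hcd
  obtain ⟨-, hasym⟩ := hor
  -- every oriented 4-cycle on four distinct vertices has a chord
  have key : ∀ v₁ v₂ v₃ v₄ : V,
      v₁ ≠ v₂ → v₁ ≠ v₃ → v₁ ≠ v₄ → v₂ ≠ v₃ → v₂ ≠ v₄ → v₃ ≠ v₄ →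
      E v₁ v₂ → E v₂ v₃ → E v₃ v₄ → E v₄ v₁ →
      E v₁ v₃ ∨ E v₃ v₁ ∨ E v₂ v₄ ∨ E v₄ v₂ := by
    intro v₁ v₂ v₃ v₄ n1 n2 n3 n4 n5 n6 e1 e2 e3 e4
    by_contra h
    push Not at h
    exact hC4 ⟨v₁, v₂, v₃, v₄, n1, n2, n3, n4, n5, n6, e1, e2, e3, e4,
      hasym _ _ e1, hasym _ _ e2, hasym _ _ e3, hasym _ _ e4, h.1, h.2.1, h.2.2.1, h.2.2.2⟩
  have k1 := key a b c d hab hac had hbc hbd hcd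
  have k2 := key a b d c hab had hac hbd hbc hcd.symm
  have k3 := key a c b d hac hab had hbc.symm hcd hbd
  have k4 := key a c d b hac had hab hcd hbc.symm hbd.symm
  have k5 := key a d b c had hab hac hbd.symm hcd.symm hbc
  have k6 := key a d c b had hac hab hcd.symm hbd.symm hbc.symm
  have s1 := hasym a b
  have s2 := hasym a c
  have s3 := hasym a d
  have s4 := hasym b c
  have s5 := hasym b d
  have s6 := hasym c d
  clear key hasym hC4
  unfold FDFedge
  grind
end

section
/- Let S ⊆ ℝ be a set such that x + y ≠ 0 for all x, y ∈ S. Then the orgraph Γ_K(S) is C⃗4-free: it contains no induced C⃗4. -/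
open Finset

/-- The Kostochka orgraph Γ_K(S) on ℤ/3 × S is C⃗₄-free whenever x + y ≠ 0
for all x, y ∈ S. -/
theorem stmt6 (S : Set ℝ) (hS : ∀ x ∈ S, ∀ y ∈ S, x + y ≠ 0) :
    ¬ HasInducedC4 (fun p q : ZMod 3 × {x : ℝ // x ∈ S} =>
      ((p.2 : ℝ) + (q.2 : ℝ) < 0 ∧ q.1 = p.1 + 1) ∨
      ((p.2 : ℝ) + (q.2 : ℝ) > 0 ∧ q.1 = p.1 - 1)) := by
  rintro ⟨⟨a, x, hx⟩, ⟨b, y, hy⟩, ⟨c, z, hz⟩, ⟨d, w, hw⟩, -, -, -, -, -, -,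
    h12, h23, h34, h41, -, -, -, -, n13, n31, n24, n42⟩
  dsimp only at *
  -- nonadjacent vertices have the same first coordinate
  have key : ∀ a c : ZMod 3, c = a + 1 ∨ c = a - 1 ∨ c = a := by decide
  have same : ∀ (a c : ZMod 3) (x z : ℝ), x + z ≠ 0 →
      ¬ ((x + z < 0 ∧ c = a + 1) ∨ (x + z > 0 ∧ c = a - 1)) →
      ¬ ((z + x < 0 ∧ a = c + 1) ∨ (z + x > 0 ∧ a = c - 1)) → c = a := by
    intro a c x z hne h1 h2
    rw [add_comm z x] at h2
    rcases key a c with h | h | h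
    · rcases lt_or_gt_of_ne hne with h0 | h0
      · exact absurd (Or.inl ⟨h0, h⟩) h1
      · exact absurd (Or.inr ⟨h0, by rw [h]; ring⟩) h2
    · rcases lt_or_gt_of_ne hne with h0 | h0
      · exact absurd (Or.inl ⟨h0, by rw [h]; ring⟩) h2
      · exact absurd (Or.inr ⟨h0, h⟩) h1
    · exact h
  have hca := same a c x z (hS x hx z hz) n13 n31
  have hdb := same b d y w (hS y hy w hw) n24 n42
  subst hca hdb
  have k1 : ∀ a b : ZMod 3, b = a + 1 → a ≠ b + 1 := by decide
  have k2 : ∀ a b : ZMod 3, b = a - 1 → a ≠ b - 1 := by decide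
  have k3 : ∀ a b : ZMod 3, b = a + 1 → b ≠ a - 1 := by decide
  rcases h12 with ⟨p1, e1⟩ | ⟨p1, e1⟩ <;> rcases h23 with ⟨p2, e2⟩ | ⟨p2, e2⟩ <;>
    rcases h34 with ⟨p3, e3⟩ | ⟨p3, e3⟩ <;> rcases h41 with ⟨p4, e4⟩ | ⟨p4, e4⟩ <;>
    first
    | linarith
    | exact k1 _ _ e1 e2
    | exact k1 _ _ e1 e4
    | exact k2 _ _ e1 e2
    | exact k2 _ _ e1 e4
    | exact k3 _ _ e1 e3
    | exact k3 _ _ e3 e1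
end

section
/- For every ε > 0 there exists N such that for every finite set S ⊆ ℝ with |S| ≥ N and x + y ≠ 0 for all x, y ∈ S, the edge density of the 3-uniform hypergraph FDF(Γ_K(S)) on its 3|S| vertices differs from 4/9 by at most ε; that is, | e(FDF(Γ_K(S)))/C(3|S|,3) − 4/9 | ≤ ε. -/
open Finset

/-- Arc from colour `a` to colour `b`, when the sign of the sum is negative iff `s`. -/
def arcB (s : Bool) (a b : ZMod 3) : Bool :=
  if s then decide (b = a + 1) else decide (b = a - 1)

/-- Boolean version of the edge predicate. -/
def fdfB (s t r : Bool) (a b c : ZMod 3) : Bool :=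
  (arcB s a b && arcB t a c) || (arcB s b a && arcB r b c) || (arcB t c a && arcB r c b) ||
  (!arcB s a b && !arcB s b a && !arcB t a c && !arcB t c a) ||
  (!arcB s b a && !arcB s a b && !arcB r b c && !arcB r c b) ||
  (!arcB t c a && !arcB t a c && !arcB r c b && !arcB r b c)

set_option maxRecDepth 100000 in
theorem sum_fdfB : ∀ s t r : Bool,
    ∑ a : ZMod 3, ∑ b : ZMod 3, ∑ c : ZMod 3, (if fdfB s t r a b c = true then 1 else 0) = 12 := by
  decide

theorem FDFedge.swap12 {V : Type*} {E : V → V → Prop} {u v w : V} (h : FDFedge E u v w) :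
    FDFedge E v u w := by
  unfold FDFedge at *; tauto

theorem FDFedge.swap23 {V : Type*} {E : V → V → Prop} {u v w : V} (h : FDFedge E u v w) :
    FDFedge E u w v := by
  unfold FDFedge at *; tauto

open Classical in
theorem six_mul_fdfCount (V : Type*) [Fintype V] (E : V → V → Prop) :
    6 * fdfCount V E = ((Finset.univ : Finset (V × V × V)).filter (fun p =>
      (p.1 ≠ p.2.1 ∧ p.1 ≠ p.2.2 ∧ p.2.1 ≠ p.2.2) ∧ FDFedge E p.1 p.2.1 p.2.2)).card := by
  unfold fdfCount
  rw [Finset.card_eq_sum_card_fiberwise (f := fun p : V × V × V => ({p.1, p.2.1, p.2.2} : Finset V))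
    (t := (Finset.univ.powersetCard 3).filter (fun s : Finset V =>
    ∃ u v w : V, u ≠ v ∧ u ≠ w ∧ v ≠ w ∧ s = {u, v, w} ∧ FDFedge E u v w))]
  · rw [Finset.sum_const_nat (m := 6), mul_comm]
    intro s hs
    rw [Finset.mem_filter] at hs
    obtain ⟨-, u, v, w, huv, huw, hvw, rfl, h⟩ := hs
    have : (((Finset.univ : Finset (V × V × V)).filter (fun p =>
      (p.1 ≠ p.2.1 ∧ p.1 ≠ p.2.2 ∧ p.2.1 ≠ p.2.2) ∧ FDFedge E p.1 p.2.1 p.2.2)).filter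
      (fun p => ({p.1, p.2.1, p.2.2} : Finset V) = {u, v, w})) =
      {(u, v, w), (u, w, v), (v, u, w), (v, w, u), (w, u, v), (w, v, u)} := by
      ext ⟨a, b, c⟩
      simp only [Finset.mem_filter, Finset.mem_univ, true_and, Finset.mem_insert,
        Finset.mem_singleton, Prod.mk.injEq]
      constructor
      · rintro ⟨⟨⟨h1, h2, h3⟩, -⟩, he⟩
        have ha : a ∈ ({u, v, w} : Finset V) := by rw [← he]; simp
        have hb : b ∈ ({u, v, w} : Finset V) := by rw [← he]; simp
        have hc : c ∈ ({u, v, w} : Finset V) := by rw [← he]; simp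
        simp only [Finset.mem_insert, Finset.mem_singleton] at ha hb hc
        grind
      · rintro (⟨rfl, rfl, rfl⟩ | ⟨rfl, rfl, rfl⟩ | ⟨rfl, rfl, rfl⟩ | ⟨rfl, rfl, rfl⟩ |
          ⟨rfl, rfl, rfl⟩ | ⟨rfl, rfl, rfl⟩)
        · exact ⟨⟨⟨huv, huw, hvw⟩, h⟩, rfl⟩
        · exact ⟨⟨⟨huw, huv, hvw.symm⟩, h.swap23⟩, by ext; simp; tauto⟩
        · exact ⟨⟨⟨huv.symm, hvw, huw⟩, h.swap12⟩, by ext; simp; tauto⟩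
        · exact ⟨⟨⟨hvw, huv.symm, huw.symm⟩, h.swap12.swap23⟩, by ext; simp; tauto⟩
        · exact ⟨⟨⟨huw.symm, hvw.symm, huv⟩, h.swap23.swap12⟩, by ext; simp; tauto⟩
        · exact ⟨⟨⟨hvw.symm, huw.symm, huv.symm⟩, h.swap23.swap12.swap23⟩, by ext; simp; tauto⟩
    rw [this]
    have n1 := huv.symm
    have n2 := huw.symm
    have n3 := hvw.symm
    simp [Finset.card_insert_of_notMem, *]
  · rintro ⟨a, b, c⟩ hp
    simp only [Finset.coe_filter, Finset.mem_univ, true_and, Set.mem_setOf_eq] at hp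
    obtain ⟨⟨h1, h2, h3⟩, h⟩ := hp
    simp only [Finset.coe_filter, Set.mem_setOf_eq, Finset.mem_powersetCard, Finset.subset_univ,
      true_and]
    exact ⟨Finset.card_eq_three.2 ⟨a, b, c, h1, h2, h3, rfl⟩, a, b, c, h1, h2, h3, rfl, h⟩

open Classical in
theorem fdfCount_bounds (V : Type*) [Fintype V] (E : V → V → Prop) (T : ℕ)
    (hT : ((Finset.univ : Finset (V × V × V)).filter
      (fun p => FDFedge E p.1 p.2.1 p.2.2)).card = T) :
    6 * fdfCount V E ≤ T ∧ T ≤ 6 * fdfCount V E + 3 * (Fintype.card V) ^ 2 := by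
  rw [six_mul_fdfCount, ← hT]
  constructor
  · apply Finset.card_le_card
    intro p; simp
  · let A : Finset (V × V × V) := (Finset.univ : Finset (V × V)).image (fun q => (q.1, q.1, q.2))
    let B : Finset (V × V × V) := (Finset.univ : Finset (V × V)).image (fun q => (q.1, q.2, q.1))
    let C : Finset (V × V × V) := (Finset.univ : Finset (V × V)).image (fun q => (q.1, q.2, q.2))
    have hA : A.card ≤ Fintype.card V ^ 2 :=
      Finset.card_image_le.trans (by simp [sq])
    have hB : B.card ≤ Fintype.card V ^ 2 :=
      Finset.card_image_le.trans (by simp [sq])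
    have hC : C.card ≤ Fintype.card V ^ 2 :=
      Finset.card_image_le.trans (by simp [sq])
    set D := (Finset.univ : Finset (V × V × V)).filter (fun p =>
      (p.1 ≠ p.2.1 ∧ p.1 ≠ p.2.2 ∧ p.2.1 ≠ p.2.2) ∧ FDFedge E p.1 p.2.1 p.2.2) with hD
    have hsub : (Finset.univ : Finset (V × V × V)).filter
      (fun p => FDFedge E p.1 p.2.1 p.2.2) ⊆ D ∪ (A ∪ (B ∪ C)) := by
      rintro ⟨a, b, c⟩ h
      simp [hD, A, B, C] at h ⊢
      grind
    have := Finset.card_le_card hsub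
    have h1 := Finset.card_union_le D (A ∪ (B ∪ C))
    have h2 := Finset.card_union_le A (B ∪ C)
    have h3 := Finset.card_union_le B C
    omega

/-- The orgraph relation of the theorem. -/
def relK (S : Finset ℝ) (p q : ZMod 3 × {x : ℝ // x ∈ S}) : Prop :=
  ((p.2 : ℝ) + (q.2 : ℝ) < 0 ∧ q.1 = p.1 + 1) ∨ ((p.2 : ℝ) + (q.2 : ℝ) > 0 ∧ q.1 = p.1 - 1)

open Classical in
theorem relK_iff (S : Finset ℝ) (hS : ∀ x ∈ S, ∀ y ∈ S, x + y ≠ 0)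
    (a b : ZMod 3) (x y : {x : ℝ // x ∈ S}) :
    relK S (a, x) (b, y) ↔ arcB (decide ((x : ℝ) + y < 0)) a b = true := by
  have h0 := hS x x.2 y y.2
  unfold relK arcB
  by_cases h : (x : ℝ) + y < 0
  · simp [h, not_lt.2 h.le]
  · have h' : (x : ℝ) + y > 0 := lt_of_le_of_ne (not_lt.1 h) h0.symm
    simp [h, h']

open Classical in
theorem total_count (S : Finset ℝ) (hS : ∀ x ∈ S, ∀ y ∈ S, x + y ≠ 0) :
    ((Finset.univ : Finset ((ZMod 3 × {x : ℝ // x ∈ S}) × (ZMod 3 × {x : ℝ // x ∈ S}) ×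
      (ZMod 3 × {x : ℝ // x ∈ S}))).filter
      (fun p => FDFedge (relK S) p.1 p.2.1 p.2.2)).card = 12 * S.card ^ 3 := by
  have key : ∀ x y z : {x : ℝ // x ∈ S}, ∑ a : ZMod 3, ∑ b : ZMod 3, ∑ c : ZMod 3,
      (if FDFedge (relK S) (a, x) (b, y) (c, z) then 1 else 0) = 12 := by
    intro x y z
    rw [← sum_fdfB (decide ((x : ℝ) + y < 0)) (decide ((x : ℝ) + z < 0)) (decide ((y : ℝ) + z < 0))]
    refine Finset.sum_congr rfl fun a _ => Finset.sum_congr rfl fun b _ =>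
      Finset.sum_congr rfl fun c _ => ?_
    refine if_congr ?_ rfl rfl
    unfold FDFedge fdfB
    simp only [relK_iff S hS, add_comm (y : ℝ) (x : ℝ), add_comm (z : ℝ) (x : ℝ),
      add_comm (z : ℝ) (y : ℝ), Bool.or_eq_true, Bool.and_eq_true, Bool.not_eq_true',
      Bool.not_eq_true, or_assoc, and_assoc]
  rw [Finset.card_filter]
  simp only [Fintype.sum_prod_type]
  have e : ∀ f : ZMod 3 → {x : ℝ // x ∈ S} → ZMod 3 → {x : ℝ // x ∈ S} → ZMod 3 →
      {x : ℝ // x ∈ S} → ℕ, ∑ a, ∑ x, ∑ b, ∑ y, ∑ c, ∑ z, f a x b y c z =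
      ∑ x, ∑ y, ∑ z, ∑ a, ∑ b, ∑ c, f a x b y c z := by
    intro f
    rw [Finset.sum_comm]
    refine Finset.sum_congr rfl fun x _ => ?_
    have : ∀ a, ∑ b, ∑ y, ∑ c, ∑ z, f a x b y c z = ∑ y, ∑ z, ∑ b, ∑ c, f a x b y c z := by
      intro a
      rw [Finset.sum_comm]
      refine Finset.sum_congr rfl fun y _ => ?_
      have : ∀ b, ∑ c, ∑ z, f a x b y c z = ∑ z, ∑ c, f a x b y c z :=
        fun b => Finset.sum_comm
      simp only [this]
      rw [Finset.sum_comm]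
    simp only [this]
    rw [Finset.sum_comm]
    refine Finset.sum_congr rfl fun y _ => ?_
    rw [Finset.sum_comm]
  rw [e]
  simp only [key]
  simp
  ring

/-- The edge density of FDF(Γ_K(S)) on its 3|S| vertices tends to 4/9 as
|S| → ∞, over finite S ⊆ ℝ with x + y ≠ 0 for all x, y ∈ S. -/
theorem stmt7 :
    ∀ ε : ℝ, ε > 0 → ∃ N : ℕ, ∀ S : Finset ℝ, N ≤ S.card →
      (∀ x ∈ S, ∀ y ∈ S, x + y ≠ 0) →
      |(fdfCount (ZMod 3 × {x : ℝ // x ∈ S})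
          (fun p q => ((p.2 : ℝ) + (q.2 : ℝ) < 0 ∧ q.1 = p.1 + 1) ∨
            ((p.2 : ℝ) + (q.2 : ℝ) > 0 ∧ q.1 = p.1 - 1)) : ℝ) /
          (((3 * S.card).choose 3 : ℕ) : ℝ) - 4 / 9| ≤ ε := by
  intro ε hε
  refine ⟨⌈1 / ε⌉₊ + 2, fun S hN hS => ?_⟩
  change |(fdfCount (ZMod 3 × {x : ℝ // x ∈ S}) (relK S) : ℝ) / _ - 4 / 9| ≤ ε
  obtain ⟨h1, h2⟩ := fdfCount_bounds _ (relK S) _ (total_count S hS)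
  generalize fdfCount (ZMod 3 × {x : ℝ // x ∈ S}) (relK S) = F at *
  have hc : Fintype.card (ZMod 3 × {x : ℝ // x ∈ S}) = 3 * S.card := by simp
  rw [hc] at h2
  generalize S.card = n at *
  have h1' : 6 * (F : ℝ) ≤ 12 * (n : ℝ) ^ 3 := by exact_mod_cast h1
  have h2' : 12 * (n : ℝ) ^ 3 ≤ 6 * (F : ℝ) + 3 * (3 * n) ^ 2 := by exact_mod_cast h2
  have hn : 1 / ε + 2 ≤ (n : ℝ) := by
    have : ((⌈1 / ε⌉₊ + 2 : ℕ) : ℝ) ≤ n := by exact_mod_cast hN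
    push_cast at this
    linarith [Nat.le_ceil (1 / ε)]
  have hpos : 0 < 1 / ε := by positivity
  have hC : (((3 * n).choose 3 : ℕ) : ℝ) = n * (3 * n - 1) * (3 * n - 2) / 2 := by
    rw [Nat.cast_choose_eq_descPochhammer_div]
    simp [descPochhammer_succ_right, Nat.factorial]
    ring
  rw [hC]
  have hCpos : (0 : ℝ) < n * (3 * n - 1) * (3 * n - 2) / 2 := by
    have : (0 : ℝ) < n := by linarith
    have : (0 : ℝ) < 3 * n - 1 := by linarith
    have : (0 : ℝ) < 3 * n - 2 := by linarith
    positivity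
  have hεn : 1 ≤ ε * (n - 1) := by
    have : ε * (1 / ε) ≤ ε * (n - 1) := mul_le_mul_of_nonneg_left (by linarith) hε.le
    rwa [mul_one_div_cancel hε.ne'] at this
  have hbig : 27 * (n : ℝ) ^ 2 ≤ ε * (27 * n ^ 3 - 27 * n ^ 2 + 6 * n) := by
    have h3 : 27 * (n : ℝ) ^ 2 * 1 ≤ 27 * (n : ℝ) ^ 2 * (ε * (n - 1)) :=
      mul_le_mul_of_nonneg_left hεn (by positivity)
    have h4 : 0 ≤ ε * (6 * n) := by positivity
    nlinarith
  have hn2 : (n : ℝ) ≤ (n : ℝ) ^ 2 := by nlinarith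
  have hn0 : (0 : ℝ) ≤ n := by positivity
  rw [abs_le]
  constructor
  · rw [le_sub_iff_add_le, le_div_iff₀ hCpos]
    nlinarith
  · rw [sub_le_iff_le_add, div_le_iff₀ hCpos]
    nlinarith
end

section
/- For every ε > 0 there exists N such that for every n ≥ N there exists a Turán 3-uniform hypergraph on n vertices with at most (4/9 + ε)·C(n,3) edges. In particular, the Turán density π_min(I³₄) = lim_n ex_min(n; I³₄)/C(n,3) is at most 4/9. -/
open Finset

/-- Colour of a vertex: its residue mod 3. -/
def tcol {n : ℕ} (i : Fin n) : Fin 3 := ⟨i.val % 3, Nat.mod_lt _ (by norm_num)⟩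

/-- Colour class. -/
def tcls (n : ℕ) (a : Fin 3) : Finset (Fin n) := univ.filter (fun i => tcol i = a)

/-- Turán's construction. -/
def tH (n : ℕ) : Finset (Finset (Fin n)) :=
  univ.biUnion (fun a : Fin 3 => (tcls n a).powersetCard 3 ∪
    (((tcls n a).powersetCard 2) ×ˢ (tcls n (a + 1))).image (fun p => insert p.2 p.1))

lemma tcls_card (n : ℕ) (a : Fin 3) : (tcls n a).card ≤ (n + 2) / 3 := by
  have h : (tcls n a).card ≤ (range ((n + 2) / 3)).card := by
    apply card_le_card_of_injOn (fun i => i.val / 3)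
    · intro i _
      have := i.isLt
      simp only [coe_range, Set.mem_Iio]
      omega
    · intro i hi j hj hij
      simp only [tcls, tcol, coe_filter, mem_univ, true_and, Set.mem_ofPred_eq, Fin.ext_iff] at hi hj
      simp only at hij
      ext
      omega
  simpa using h

lemma tH_mem {n : ℕ} (x y z : Fin n) (hxy : x ≠ y) (hxz : x ≠ z) (hyz : y ≠ z)
    (h : tcol x = tcol y) (h' : tcol z = tcol x ∨ tcol z = tcol x + 1) :
    ({x, y, z} : Finset (Fin n)) ∈ tH n := by
  simp only [tH, mem_biUnion, mem_univ, true_and, mem_union, mem_image, mem_product,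
    mem_powersetCard, Prod.exists]
  refine ⟨tcol x, ?_⟩
  rcases h' with h' | h'
  · left
    refine ⟨?_, card_eq_three.2 ⟨x, y, z, hxy, hxz, hyz, rfl⟩⟩
    intro i hi
    simp only [mem_insert, mem_singleton] at hi
    rcases hi with rfl | rfl | rfl <;> simp [tcls, h, h']
  · right
    refine ⟨{x, y}, z, ⟨⟨?_, card_pair hxy⟩, by simp [tcls, h']⟩, ?_⟩
    · intro i hi
      simp only [mem_insert, mem_singleton] at hi
      rcases hi with rfl | rfl <;> simp [tcls, h]
    · ext i
      simp only [mem_insert, mem_singleton]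
      tauto

lemma tH_card3 {n : ℕ} (s : Finset (Fin n)) (hs : s ∈ tH n) : s.card = 3 := by
  simp only [tH, mem_biUnion, mem_univ, true_and, mem_union, mem_image, mem_product,
    mem_powersetCard, Prod.exists] at hs
  obtain ⟨a, ⟨-, h⟩ | ⟨p, z, ⟨⟨hp, hc⟩, hz⟩, rfl⟩⟩ := hs
  · exact h
  · rw [card_insert_of_notMem, hc]
    intro hzp
    have h1 := hp hzp
    simp only [tcls, mem_filter, mem_univ, true_and] at h1 hz
    rw [h1] at hz
    have hne : ∀ a : Fin 3, a ≠ a + 1 := by decide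
    exact hne a hz

lemma four_col : ∀ a b c d : Fin 3,
    (a = b ∧ (c = a ∨ c = a + 1)) ∨ (a = b ∧ (d = a ∨ d = a + 1)) ∨
    (a = c ∧ (b = a ∨ b = a + 1)) ∨ (a = c ∧ (d = a ∨ d = a + 1)) ∨
    (a = d ∧ (b = a ∨ b = a + 1)) ∨ (a = d ∧ (c = a ∨ c = a + 1)) ∨
    (b = c ∧ (a = b ∨ a = b + 1)) ∨ (b = c ∧ (d = b ∨ d = b + 1)) ∨
    (b = d ∧ (a = b ∨ a = b + 1)) ∨ (b = d ∧ (c = b ∨ c = b + 1)) ∨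
    (c = d ∧ (a = c ∨ a = c + 1)) ∨ (c = d ∧ (b = c ∨ b = c + 1)) := by
  decide

lemma tH_turan {n : ℕ} (s : Finset (Fin n)) (hs : s.card = 4) : ∃ t ∈ tH n, t ⊆ s := by
  obtain ⟨a, b, c, d, hab, hac, had, hbc, hbd, hcd, rfl⟩ := card_eq_four.1 hs
  have key : ∀ x y z : Fin n, x ∈ ({a, b, c, d} : Finset (Fin n)) →
      y ∈ ({a, b, c, d} : Finset (Fin n)) → z ∈ ({a, b, c, d} : Finset (Fin n)) →
      x ≠ y → x ≠ z → y ≠ z →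
      (tcol x = tcol y ∧ (tcol z = tcol x ∨ tcol z = tcol x + 1)) →
      ∃ t ∈ tH n, t ⊆ ({a, b, c, d} : Finset (Fin n)) := by
    intro x y z hx hy hz hxy hxz hyz h
    refine ⟨_, tH_mem x y z hxy hxz hyz h.1 h.2, ?_⟩
    intro i hi
    simp only [mem_insert, mem_singleton] at hi
    rcases hi with rfl | rfl | rfl <;> assumption
  have ha : a ∈ ({a, b, c, d} : Finset (Fin n)) := by simp
  have hb : b ∈ ({a, b, c, d} : Finset (Fin n)) := by simp
  have hc : c ∈ ({a, b, c, d} : Finset (Fin n)) := by simp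
  have hd : d ∈ ({a, b, c, d} : Finset (Fin n)) := by simp
  rcases four_col (tcol a) (tcol b) (tcol c) (tcol d) with
    h | h | h | h | h | h | h | h | h | h | h | h
  · exact key a b c ha hb hc hab hac hbc h
  · exact key a b d ha hb hd hab had hbd h
  · exact key a c b ha hc hb hac hab hbc.symm h
  · exact key a c d ha hc hd hac had hcd h
  · exact key a d b ha hd hb had hab hbd.symm h
  · exact key a d c ha hd hc had hac hcd.symm h
  · exact key b c a hb hc ha hbc hab.symm hac.symm h
  · exact key b c d hb hc hd hbc hbd hcd h
  · exact key b d a hb hd ha hbd hab.symm had.symm h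
  · exact key b d c hb hd hc hbd hbc hcd.symm h
  · exact key c d a hc hd ha hcd hac.symm had.symm h
  · exact key c d b hc hd hb hcd hbc.symm hbd.symm h

lemma tH_card (n : ℕ) : ((tH n).card : ℝ) ≤ 2 * (((n + 2) / 3 : ℕ) : ℝ) ^ 3 := by
  set m := (n + 2) / 3 with hm
  have h1 : (tH n).card ≤ ∑ _a : Fin 3, (m.choose 3 + m.choose 2 * m) := by
    refine card_biUnion_le.trans (sum_le_sum fun a _ => ?_)
    refine (card_union_le _ _).trans (add_le_add ?_ (card_image_le.trans ?_))
    · rw [card_powersetCard]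
      exact Nat.choose_le_choose _ (tcls_card n a)
    · rw [card_product, card_powersetCard]
      exact Nat.mul_le_mul (Nat.choose_le_choose _ (tcls_card n a)) (tcls_card n _)
  have h2 : ((tH n).card : ℝ) ≤ 3 * ((m.choose 3 : ℝ) + (m.choose 2 : ℝ) * m) := by
    have : ((tH n).card : ℝ) ≤ ((∑ _a : Fin 3, (m.choose 3 + m.choose 2 * m) : ℕ) : ℝ) := by
      exact_mod_cast h1
    simpa using this
  have h3 : (m.choose 3 : ℝ) ≤ (m : ℝ) ^ 3 / 6 := by
    simpa [Nat.factorial] using Nat.choose_le_pow_div (α := ℝ) 3 m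
  have h4 : (m.choose 2 : ℝ) ≤ (m : ℝ) ^ 2 / 2 := by
    simpa [Nat.factorial] using Nat.choose_le_pow_div (α := ℝ) 2 m
  have h5 : (m.choose 2 : ℝ) * m ≤ (m : ℝ) ^ 2 / 2 * m := by gcongr
  nlinarith

lemma choose_three_real (n : ℕ) : (n.choose 3 : ℝ) = n * (n - 1) * (n - 2) / 6 := by
  rw [Nat.cast_choose_eq_descPochhammer_div]
  simp [descPochhammer_succ_right, Nat.factorial]

/-- For every ε > 0 and all large n there is a Turán 3-graph on n vertices with
at most (4/9 + ε)·C(n,3) edges; in particular π_min(I³₄) ≤ 4/9. -/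
theorem stmt8 :
    ∀ ε : ℝ, ε > 0 → ∃ N : ℕ, ∀ n : ℕ, N ≤ n →
      ∃ H : Finset (Finset (Fin n)),
        (∀ s ∈ H, s.card = 3) ∧
        (∀ s : Finset (Fin n), s.card = 4 → ∃ t ∈ H, t ⊆ s) ∧
        (H.card : ℝ) ≤ ((4 : ℝ) / 9 + ε) * (n.choose 3 : ℝ) := by
  intro ε hε
  refine ⟨⌈48 / ε⌉₊ + 4, fun n hn => ⟨tH n, tH_card3, tH_turan, (tH_card n).trans ?_⟩⟩
  have hn4 : (4 : ℝ) ≤ n := by exact_mod_cast (by omega : 4 ≤ n)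
  have hnε : 48 ≤ ε * n := by
    have h1 : 48 / ε ≤ n := (Nat.le_ceil _).trans (by exact_mod_cast (by omega))
    rw [div_le_iff₀ hε] at h1
    linarith
  have hm : (((n + 2) / 3 : ℕ) : ℝ) ≤ ((n : ℝ) + 2) / 3 := by
    simpa using (Nat.cast_div_le (α := ℝ) (m := n + 2) (n := 3))
  have hm3 : (((n + 2) / 3 : ℕ) : ℝ) ^ 3 ≤ (((n : ℝ) + 2) / 3) ^ 3 := by gcongr
  rw [choose_three_real]
  generalize (((n + 2) / 3 : ℕ) : ℝ) = m at *
  generalize (n : ℝ) = x at *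
  have e1 : x ^ 2 / 4 ≤ (x - 1) * (x - 2) := by nlinarith
  have e2 : 48 * (x ^ 2 / 4) ≤ (ε * x) * ((x - 1) * (x - 2)) := by
    apply mul_le_mul hnε e1 (by positivity) (by linarith)
  nlinarith
end

section
/- For every ε > 0 there exists N such that for every n ≥ N, every orgraph Γ on n vertices (not necessarily C⃗4-free) whose underlying graph has edge density at least 2/3 satisfies: the number of edges of FDF(Γ) is at least (4/9 − ε)·C(n,3). -/
open Finset

open Classical in
theorem orgraph_star_count {n : ℕ} (R : Fin n → Fin n → Prop) (hR : ∀ v, ¬ R v v) (v : Fin n) :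
    (((Finset.univ : Finset (Fin n)).powersetCard 3).filter
      (fun s => v ∈ s ∧ ∀ w ∈ s, w ≠ v → R v w)).card
      = ((Finset.univ.filter (fun w => R v w)).card).choose 2 := by
  rw [← Finset.card_powersetCard]
  refine Finset.card_bij' (fun s _ => s.erase v) (fun t _ => insert v t) ?_ ?_ ?_ ?_
  · intro s hs
    simp only [mem_filter, mem_powersetCard, subset_univ, true_and] at hs ⊢
    obtain ⟨hc, hv, hw⟩ := hs
    refine ⟨fun w hw' => ?_, ?_⟩
    · rw [mem_erase] at hw'
      simpa using hw w hw'.2 hw'.1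
    · rw [card_erase_of_mem hv, hc]
  · intro t ht
    simp only [mem_filter, mem_powersetCard, subset_univ, true_and] at ht ⊢
    obtain ⟨hsub, hc⟩ := ht
    have hvt : v ∉ t := fun h => hR v (by simpa using hsub h)
    refine ⟨by rw [card_insert_of_notMem hvt, hc], mem_insert_self _ _, ?_⟩
    intro w hw hne
    have : w ∈ t := by simpa [hne] using hw
    simpa using hsub this
  · intro s hs
    simp only [mem_filter] at hs
    exact insert_erase hs.2.1
  · intro t ht
    simp only [mem_powersetCard] at ht
    have hvt : v ∉ t := fun h => hR v (by simpa using ht.1 h)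
    exact erase_insert hvt

open Classical in
theorem orgraph_star_sum {n : ℕ} (R : Fin n → Fin n → Prop) (hR : ∀ v, ¬ R v v) :
    ∑ v, ((Finset.univ.filter (fun w => R v w)).card).choose 2 =
    ∑ s ∈ (Finset.univ : Finset (Fin n)).powersetCard 3,
      ((Finset.univ.filter (fun v => v ∈ s ∧ ∀ w ∈ s, w ≠ v → R v w)).card) := by
  simp_rw [← orgraph_star_count R hR]
  exact sum_card_bipartiteAbove_eq_sum_card_bipartiteBelow
    (fun (v : Fin n) (s : Finset (Fin n)) => v ∈ s ∧ ∀ w ∈ s, w ≠ v → R v w)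

open Classical in
theorem local_bound {n : ℕ} (E : Fin n → Fin n → Prop) (hE : IsOrgraph E)
    (s : Finset (Fin n)) (hs : s.card = 3) :
    3 * (Finset.univ.filter (fun v => v ∈ s ∧ ∀ w ∈ s, w ≠ v → E v w)).card
    + (Finset.univ.filter (fun v => v ∈ s ∧ ∀ w ∈ s, w ≠ v →
        (w ≠ v ∧ ¬ E v w ∧ ¬ E w v))).card
    ≤ 3 * (if (∃ u v w : Fin n, u ≠ v ∧ u ≠ w ∧ v ≠ w ∧ s = {u, v, w} ∧ FDFedge E u v w)
        then 1 else 0) := by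
  have key : ∀ v ∈ s, ∃ y z, v ≠ y ∧ v ≠ z ∧ y ≠ z ∧ s = {v, y, z} := by
    intro v hv
    have h2 : (s.erase v).card = 2 := by rw [card_erase_of_mem hv, hs]
    obtain ⟨y, z, hyz, h⟩ := Finset.card_eq_two.1 h2
    have hy : y ∈ s.erase v := by simp [h]
    have hz : z ∈ s.erase v := by simp [h]
    refine ⟨y, z, (ne_of_mem_erase hy).symm, (ne_of_mem_erase hz).symm, hyz, ?_⟩
    rw [← insert_erase hv, h]
  by_cases hX : ∃ v ∈ s, ∀ w ∈ s, w ≠ v → E v w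
  · obtain ⟨v, hv, hvE⟩ := hX
    obtain ⟨y, z, h1, h2, h3, h4⟩ := key v hv
    have hy : y ∈ s := by simp [h4]
    have hz : z ∈ s := by simp [h4]
    rw [if_pos ⟨v, y, z, h1, h2, h3, h4, Or.inl ⟨hvE y hy h1.symm, hvE z hz h2.symm⟩⟩]
    have hA : (Finset.univ.filter (fun v => v ∈ s ∧ ∀ w ∈ s, w ≠ v → E v w)).card ≤ 1 := by
      rw [Finset.card_le_one]
      intro a ha b hb
      simp only [mem_filter, mem_univ, true_and] at ha hb
      by_contra hab
      exact hE.2 a b (ha.2 b hb.1 (Ne.symm hab)) (hb.2 a ha.1 hab)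
    have hB : (Finset.univ.filter (fun v => v ∈ s ∧ ∀ w ∈ s, w ≠ v →
        (w ≠ v ∧ ¬ E v w ∧ ¬ E w v))).card = 0 := by
      rw [Finset.card_eq_zero, Finset.filter_eq_empty_iff]
      rintro a - ⟨ha, haw⟩
      by_cases hav : a = v
      · subst hav
        exact (haw y hy h1.symm).2.1 (hvE y hy h1.symm)
      · exact (haw v hv (Ne.symm hav)).2.2 (hvE a ha hav)
    omega
  · have hA : (Finset.univ.filter (fun v => v ∈ s ∧ ∀ w ∈ s, w ≠ v → E v w)).card = 0 := by
      rw [Finset.card_eq_zero, Finset.filter_eq_empty_iff]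
      rintro a - ⟨ha, haw⟩
      exact hX ⟨a, ha, haw⟩
    rw [hA]
    by_cases hY : ∃ v ∈ s, ∀ w ∈ s, w ≠ v → (w ≠ v ∧ ¬ E v w ∧ ¬ E w v)
    · obtain ⟨v, hv, hvE⟩ := hY
      obtain ⟨y, z, h1, h2, h3, h4⟩ := key v hv
      have hy := hvE y (by simp [h4]) h1.symm
      have hz := hvE z (by simp [h4]) h2.symm
      rw [if_pos ⟨v, y, z, h1, h2, h3, h4, Or.inr (Or.inr (Or.inr (Or.inl
        ⟨hy.2.1, hy.2.2, hz.2.1, hz.2.2⟩)))⟩]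
      have : (Finset.univ.filter (fun v => v ∈ s ∧ ∀ w ∈ s, w ≠ v →
        (w ≠ v ∧ ¬ E v w ∧ ¬ E w v))).card ≤ s.card := by
        apply Finset.card_le_card
        intro a ha
        exact (mem_filter.1 ha).2.1
      omega
    · have hB : (Finset.univ.filter (fun v => v ∈ s ∧ ∀ w ∈ s, w ≠ v →
        (w ≠ v ∧ ¬ E v w ∧ ¬ E w v))).card = 0 := by
        rw [Finset.card_eq_zero, Finset.filter_eq_empty_iff]
        rintro a - ⟨ha, haw⟩
        exact hY ⟨a, ha, haw⟩
      omega

open Classical in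
theorem main_count {n : ℕ} (E : Fin n → Fin n → Prop) (hE : IsOrgraph E) :
    3 * ∑ v, ((Finset.univ.filter (fun w => E v w)).card).choose 2
    + ∑ v, ((Finset.univ.filter (fun w => w ≠ v ∧ ¬ E v w ∧ ¬ E w v)).card).choose 2
    ≤ 3 * fdfCount (Fin n) E := by
  have e1 := orgraph_star_sum E hE.1
  have e2 : ∑ v, ((Finset.univ.filter (fun w => w ≠ v ∧ ¬ E v w ∧ ¬ E w v)).card).choose 2 =
      ∑ s ∈ (Finset.univ : Finset (Fin n)).powersetCard 3,
      ((Finset.univ.filter (fun v => v ∈ s ∧ ∀ w ∈ s, w ≠ v →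
        (w ≠ v ∧ ¬ E v w ∧ ¬ E w v))).card) := by
    convert orgraph_star_sum (fun v w => w ≠ v ∧ ¬ E v w ∧ ¬ E w v) (fun v h => h.1 rfl)
  rw [e1, e2, fdfCount, Finset.card_filter, Finset.mul_sum, Finset.mul_sum,
    ← Finset.sum_add_distrib]
  apply Finset.sum_le_sum
  intro s hs
  convert local_bound E hE s (mem_powersetCard.1 hs).2
  rfl

open Classical in
theorem edge_le {n : ℕ} (E : Fin n → Fin n → Prop) :
    underlyingEdgeCount (Fin n) E ≤ ∑ v, (Finset.univ.filter (fun w => E v w)).card := by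
  rw [← Finset.card_sigma, underlyingEdgeCount]
  refine le_trans (Finset.card_le_card ?_) (Finset.card_image_le (f := fun p => {p.1, p.2}))
  intro s hs
  simp only [mem_filter] at hs
  obtain ⟨-, u, v, -, rfl, h | h⟩ := hs
  · exact mem_image.2 ⟨⟨u, v⟩, by simpa using h, by ext; simp⟩
  · exact mem_image.2 ⟨⟨v, u⟩, by simpa using h, by ext; simp [or_comm]⟩

open Classical in
theorem deg_sum {n : ℕ} (E : Fin n → Fin n → Prop) (hE : IsOrgraph E) :
    2 * ∑ v, (Finset.univ.filter (fun w => E v w)).card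
    + ∑ v, (Finset.univ.filter (fun w => w ≠ v ∧ ¬ E v w ∧ ¬ E w v)).card + n = n * n := by
  have h1 : ∑ v, (Finset.univ.filter (fun w => E v w)).card
      = ∑ v, (Finset.univ.filter (fun w => E w v)).card :=
    sum_card_bipartiteAbove_eq_sum_card_bipartiteBelow E
  have h2 : ∀ v, (Finset.univ.filter (fun w => E v w)).card
      + (Finset.univ.filter (fun w => E w v)).card
      + (Finset.univ.filter (fun w => w ≠ v ∧ ¬ E v w ∧ ¬ E w v)).card + 1 = n := by
    intro v
    have : ∑ w : Fin n, ((if E v w then 1 else 0) + (if E w v then 1 else 0)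
      + (if (w ≠ v ∧ ¬ E v w ∧ ¬ E w v) then 1 else 0) + (if w = v then 1 else 0)) = n := by
      rw [Finset.sum_congr rfl (g := fun _ => 1)]
      · simp
      · intro w _
        have a1 := hE.1 v
        have a2 := hE.2 v w
        by_cases hw : w = v
        · subst hw; simp [a1]
        · by_cases h : E v w
          · simp [h, a2 h, hw]
          · by_cases h' : E w v <;> simp [h, h', hw]
    simpa only [Finset.sum_add_distrib, ← Finset.card_filter, Finset.filter_eq', mem_univ,
      if_true, card_singleton] using this
  have h3 := Finset.sum_congr (rfl : (univ : Finset (Fin n)) = univ) (fun v _ => h2 v)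
  simp only [Finset.sum_add_distrib, Finset.sum_const, card_univ, Fintype.card_fin,
    smul_eq_mul, mul_one] at h3
  omega

theorem sum_choose_bound {n : ℕ} (a : Fin n → ℕ) :
    (∑ v, (a v : ℝ)) ^ 2 - n * ∑ v, (a v : ℝ) ≤ 2 * n * ∑ v, ((a v).choose 2 : ℝ) := by
  have h := sq_sum_le_card_mul_sum_sq (s := (univ : Finset (Fin n))) (f := fun v => (a v : ℝ))
  simp only [card_univ, Fintype.card_fin] at h
  have h2 : ∑ v, ((a v).choose 2 : ℝ) = (∑ v, (a v : ℝ) ^ 2 - ∑ v, (a v : ℝ)) / 2 := by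
    rw [← Finset.sum_sub_distrib, Finset.sum_div]
    refine Finset.sum_congr rfl fun v _ => ?_
    rw [Nat.cast_choose_two]; ring
  rw [h2]; linarith

theorem stmt9 :
    ∀ ε : ℝ, ε > 0 → ∃ N : ℕ, ∀ n : ℕ, N ≤ n → ∀ E : Fin n → Fin n → Prop,
      IsOrgraph E →
      ((2 : ℝ) / 3) * (n.choose 2 : ℝ) ≤ (underlyingEdgeCount (Fin n) E : ℝ) →
      ((4 : ℝ) / 9 - ε) * (n.choose 3 : ℝ) ≤ (fdfCount (Fin n) E : ℝ) := by
  classical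
  intro ε hε
  obtain ⟨M, hM⟩ := exists_nat_ge (1 / ε)
  refine ⟨M + 4, fun n hn E hE hd => ?_⟩
  have hn' : (M : ℝ) + 4 ≤ n := by exact_mod_cast hn
  have hM0 : (0 : ℝ) ≤ M := M.cast_nonneg
  have hεM : 1 ≤ ε * M := by
    rw [div_le_iff₀ hε] at hM; linarith
  have hc := main_count E hE
  have he : (underlyingEdgeCount (Fin n) E : ℝ) ≤ _ := Nat.cast_le.2 (edge_le E)
  have hs := deg_sum E hE
  have ha := sum_choose_bound (fun v => (Finset.univ.filter (fun w => E v w)).card)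
  have hb := sum_choose_bound
    (fun v => (Finset.univ.filter (fun w => w ≠ v ∧ ¬ E v w ∧ ¬ E w v)).card)
  have hc' : (3 : ℝ) * ∑ v, (((Finset.univ.filter (fun w => E v w)).card).choose 2 : ℝ)
    + ∑ v, (((Finset.univ.filter (fun w => w ≠ v ∧ ¬ E v w ∧ ¬ E w v)).card).choose 2 : ℝ)
    ≤ 3 * fdfCount (Fin n) E := by exact_mod_cast hc
  have hs' : (2 : ℝ) * ∑ v, ((Finset.univ.filter (fun w => E v w)).card : ℝ)
    + ∑ v, ((Finset.univ.filter (fun w => w ≠ v ∧ ¬ E v w ∧ ¬ E w v)).card : ℝ) + n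
      = n * n := by exact_mod_cast hs
  push_cast at he
  have h3 : (n.choose 3 : ℝ) = n * (n - 1) * (n - 2) / 6 := by
    have h := Nat.cast_choose_eq_ascPochhammer_div ℝ n 3
    have hx : ((n - (3 - 1) : ℕ) : ℝ) = n - 2 := by
      rw [Nat.cast_sub (by omega)]; norm_num
    rw [hx] at h
    rw [h]
    simp [ascPochhammer_succ_right, Nat.factorial]
    ring
  rw [h3]
  rw [Nat.cast_choose_two] at hd
  generalize (fdfCount (Fin n) E : ℝ) = F at *
  generalize (∑ v, (((Finset.univ.filter (fun w => E v w)).card).choose 2 : ℝ)) = A at *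
  generalize (∑ v, (((Finset.univ.filter
    (fun w => w ≠ v ∧ ¬ E v w ∧ ¬ E w v)).card).choose 2 : ℝ)) = B at *
  generalize (∑ v, ((Finset.univ.filter (fun w => E v w)).card : ℝ)) = e at *
  generalize (∑ v, ((Finset.univ.filter
    (fun w => w ≠ v ∧ ¬ E v w ∧ ¬ E w v)).card : ℝ)) = b at *
  generalize (underlyingEdgeCount (Fin n) E : ℝ) = u at *
  clear hc hs h3 hn
  generalize (n : ℝ) = x at *
  have hme : x * (x - 1) / 3 ≤ e := by linarith
  have hx : 4 ≤ x := by linarith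
  obtain rfl : b = x * (x - 1) - 2 * e := by linarith
  have h1 : 3 * (e ^ 2 - x * e) + ((x * (x - 1) - 2 * e) ^ 2 - x * (x * (x - 1) - 2 * e))
      ≤ 6 * x * F := by
    have := mul_le_mul_of_nonneg_left hc' (by linarith : 0 ≤ 2 * x)
    linarith
  have h2 : 0 ≤ (e - x * (x - 1) / 3) * (7 * (e - x * (x - 1) / 3)
      + (2 * (x * (x - 1)) / 3 - x)) := by
    apply mul_nonneg (by linarith)
    have : 0 ≤ x * (x - 4) := mul_nonneg (by linarith) (by linarith)
    linarith
  have h4 : x * (4 / 9 * (x * (x - 1) * (x - 4))) ≤ x * (6 * F) := by linarith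
  have h5 : 4 / 9 * (x * (x - 1) * (x - 4)) ≤ 6 * F := le_of_mul_le_mul_left h4 (by linarith)
  have h6 : 1 ≤ ε * (x - 2) :=
    hεM.trans (mul_le_mul_of_nonneg_left (by linarith) hε.le)
  have h7 : 0 ≤ (x * (x - 1)) * (ε * (x - 2) - 8 / 9) :=
    mul_nonneg (mul_nonneg (by linarith) (by linarith)) (by linarith)
  linarith
end

section
/- For every ε > 0 there exists N such that for every n ≥ N and every orgraph Γ on n vertices (not necessarily C⃗4-free), writing ρ for the edge density of the underlying graph of Γ, δ_ρ = 2/3 − ρ, and d₃ for the edge density of FDF(Γ), one has 4/9 − d₃ ≤ (1/3)·δ_ρ − (7/4)·δ_ρ² + ε. -/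
open Finset

open Classical in
theorem aux_triples {V : Type*} [Fintype V] (E : V → V → Prop) :
    ((univ.filter (fun p : V × V × V =>
      p.1 ≠ p.2.1 ∧ p.1 ≠ p.2.2 ∧ p.2.1 ≠ p.2.2 ∧ FDFedge E p.1 p.2.1 p.2.2)).card)
      ≤ 6 * fdfCount V E := by
  unfold fdfCount
  refine Finset.card_le_mul_card_image_of_maps_to
    (f := fun p : V × V × V => ({p.1, p.2.1, p.2.2} : Finset V)) ?_ 6 ?_
  · rintro ⟨u, v, w⟩ h
    simp only [mem_filter, mem_univ, true_and] at h
    obtain ⟨h1, h2, h3, h4⟩ := h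
    simp only [mem_filter, mem_powersetCard, subset_univ, true_and]
    exact ⟨Finset.card_eq_three.2 ⟨u, v, w, h1, h2, h3, rfl⟩, u, v, w, h1, h2, h3, rfl, h4⟩
  · intro s hs
    simp only [mem_filter, mem_powersetCard, subset_univ, true_and] at hs
    obtain ⟨-, a, b, c, hab, hac, hbc, rfl, -⟩ := hs
    refine le_trans (Finset.card_le_card (t := {(a,b,c),(a,c,b),(b,a,c),(b,c,a),(c,a,b),(c,b,a)}) ?_)
      Finset.card_le_six
    rintro ⟨u, v, w⟩ h
    simp only [mem_filter, mem_univ, true_and] at h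
    obtain ⟨⟨h1, h2, h3, -⟩, h5⟩ := h
    have hu : u ∈ ({a, b, c} : Finset V) := by rw [← h5]; simp
    have hv : v ∈ ({a, b, c} : Finset V) := by rw [← h5]; simp
    have hw : w ∈ ({a, b, c} : Finset V) := by rw [← h5]; simp
    simp only [mem_insert, mem_singleton] at hu hv hw
    simp only [mem_insert, mem_singleton, Prod.mk.injEq]
    clear h5
    rcases hu with rfl | rfl | rfl <;> rcases hv with rfl | rfl | rfl <;>
      rcases hw with rfl | rfl | rfl <;> simp_all

open Classical in
theorem aux_edges {V : Type*} [Fintype V] (E : V → V → Prop) (hE : IsOrgraph E) :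
    underlyingEdgeCount V E =
      (univ.filter (fun p : V × V => E p.1 p.2)).card := by
  unfold underlyingEdgeCount
  symm
  refine Finset.card_bij (fun p _ => ({p.1, p.2} : Finset V)) ?_ ?_ ?_
  · rintro ⟨u, v⟩ h
    simp only [mem_filter, mem_univ, true_and] at h
    have huv : u ≠ v := by rintro rfl; exact hE.1 _ h
    simp only [mem_filter, mem_powersetCard, subset_univ, true_and]
    exact ⟨Finset.card_pair huv, u, v, huv, rfl, Or.inl h⟩
  · rintro ⟨u, v⟩ h ⟨u', v'⟩ h' heq
    simp only [mem_filter, mem_univ, true_and] at h h'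
    have huv : u ≠ v := by rintro rfl; exact hE.1 _ h
    have hu : u ∈ ({u', v'} : Finset V) := by
      rw [← heq]; simp
    have hv : v ∈ ({u', v'} : Finset V) := by
      rw [← heq]; simp
    simp only [mem_insert, mem_singleton] at hu hv
    have := hE.2 _ _ h
    rcases hu with rfl | rfl <;> rcases hv with rfl | rfl <;> simp_all
  · intro s hs
    simp only [mem_filter, mem_powersetCard, subset_univ, true_and] at hs
    obtain ⟨-, u, v, huv, rfl, h | h⟩ := hs
    · exact ⟨(u, v), by simpa using h, rfl⟩
    · exact ⟨(v, u), by simpa using h, Finset.pair_comm _ _⟩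

open Classical in
theorem aux_pt {V : Type*} (E : V → V → Prop) (hE : IsOrgraph E) :
    let e : V → V → ℝ := fun u v => if E u v then 1 else 0
    let b : V → V → ℝ := fun u v => if u ≠ v ∧ ¬ E u v ∧ ¬ E v u then 1 else 0
    let g : V → V → V → ℝ := fun u v w =>
      (3 * (e u v * e u w) + b u v * b u w) - (if v = w then 3 * e u v + b u v else 0)
    ∀ u v w, g u v w + g v u w + g w u v ≤
      3 * (if u ≠ v ∧ u ≠ w ∧ v ≠ w ∧ FDFedge E u v w then (1:ℝ) else 0) := by
  intro e b g u v w
  have tri : ∀ x y, (E x y ∧ ¬ E y x) ∨ (¬ E x y ∧ E y x) ∨ (¬ E x y ∧ ¬ E y x) := by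
    intro x y
    have := hE.2 x y
    tauto
  have a1 := hE.1 u
  have a2 := hE.1 v
  have t1 := tri u v
  have t2 := tri u w
  have t3 := tri v w
  clear tri
  clear hE
  simp only [e, b, g, FDFedge]
  clear g b e
  by_cases huv : u = v
  · subst huv
    by_cases huw : u = w
    · subst huw; simp [a1]
    · have huw' := Ne.symm huw
      rcases t2 with ⟨h1, h2⟩ | ⟨h1, h2⟩ | ⟨h1, h2⟩ <;> simp [a1, h1, h2, huw, huw']
  · have huv' := Ne.symm huv
    by_cases huw : u = w
    · subst huw
      rcases t1 with ⟨h1, h2⟩ | ⟨h1, h2⟩ | ⟨h1, h2⟩ <;> simp [a1, h1, h2, huv, huv']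
    · have huw' := Ne.symm huw
      by_cases hvw : v = w
      · subst hvw
        rcases t1 with ⟨h1, h2⟩ | ⟨h1, h2⟩ | ⟨h1, h2⟩ <;> simp [a2, h1, h2, huv, huv']
      · have hvw' := Ne.symm hvw
        rcases t1 with ⟨h1, h2⟩ | ⟨h1, h2⟩ | ⟨h1, h2⟩ <;>
          rcases t2 with ⟨h3, h4⟩ | ⟨h3, h4⟩ | ⟨h3, h4⟩ <;>
          rcases t3 with ⟨h5, h6⟩ | ⟨h5, h6⟩ | ⟨h5, h6⟩ <;>
          simp [h1, h2, h3, h4, h5, h6, huv, huv', huw, huw', hvw, hvw'] <;> norm_num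

open Classical in
theorem aux_main {V : Type*} [Fintype V] (E : V → V → Prop) (hE : IsOrgraph E) :
    (Fintype.card V : ℝ) * (6 * (fdfCount V E : ℝ)) ≥
      3 * (underlyingEdgeCount V E : ℝ) ^ 2 - 3 * (Fintype.card V : ℝ) * (underlyingEdgeCount V E : ℝ)
      + ((Fintype.card V : ℝ) * ((Fintype.card V : ℝ) - 1) - 2 * (underlyingEdgeCount V E : ℝ)) ^ 2
      - (Fintype.card V : ℝ) * ((Fintype.card V : ℝ) * ((Fintype.card V : ℝ) - 1) - 2 * (underlyingEdgeCount V E : ℝ)) := by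
  set e : V → V → ℝ := fun u v => if E u v then 1 else 0 with he
  set b : V → V → ℝ := fun u v => if u ≠ v ∧ ¬ E u v ∧ ¬ E v u then 1 else 0 with hb
  set m : ℝ := (underlyingEdgeCount V E : ℝ) with hm
  have hm1 : m = ∑ u, ∑ v, e u v := by
    rw [hm, aux_edges E hE, Finset.card_filter, ← Finset.univ_product_univ, Finset.sum_product]
    push_cast
    rfl
  have hM : ∑ u, ∑ v, b u v = (Fintype.card V : ℝ) * ((Fintype.card V : ℝ) - 1) - 2 * m := by
    have h1 : ∀ u v, b u v = 1 - (if u = v then (1:ℝ) else 0) - e u v - e v u := by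
      intro u v
      have h0 := hE.1 u
      have h2 := hE.2 u v
      simp only [hb, he]
      by_cases huv : u = v
      · subst huv; simp [h0]
      · by_cases h3 : E u v
        · simp [huv, h3, h2 h3]
        · by_cases h4 : E v u <;> simp [huv, h3, h4]
    simp only [h1, Finset.sum_sub_distrib]
    rw [Finset.sum_comm (f := fun u v => e v u), ← hm1]
    simp
    ring
  have hF : ∑ u, ∑ v, ∑ w, (if u ≠ v ∧ u ≠ w ∧ v ≠ w ∧ FDFedge E u v w then (1:ℝ) else 0)
      ≤ 6 * (fdfCount V E : ℝ) := by
    have := aux_triples E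
    rw [Finset.card_filter, ← Finset.univ_product_univ, Finset.sum_product] at this
    simp only [← Finset.univ_product_univ, Finset.sum_product] at this
    exact_mod_cast this
  set g : V → V → V → ℝ := fun u v w =>
    (3 * (e u v * e u w) + b u v * b u w) - (if v = w then 3 * e u v + b u v else 0) with hg
  have hpt : ∀ u v w, g u v w + g v u w + g w u v ≤
      3 * (if u ≠ v ∧ u ≠ w ∧ v ≠ w ∧ FDFedge E u v w then (1:ℝ) else 0) := by
    exact aux_pt E hE
  have hS : 3 * ∑ u, ∑ v, ∑ w, g u v w ≤ 3 * (6 * (fdfCount V E : ℝ)) := by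
    calc 3 * ∑ u, ∑ v, ∑ w, g u v w
        = ∑ u, ∑ v, ∑ w, (g u v w + g v u w + g w u v) := by
          simp only [Finset.sum_add_distrib]
          have h1 : ∑ u, ∑ v, ∑ w, g v u w = ∑ u, ∑ v, ∑ w, g u v w := Finset.sum_comm
          have h2 : ∑ u, ∑ v, ∑ w, g w u v = ∑ u, ∑ v, ∑ w, g u v w := by
            rw [Finset.sum_congr rfl (fun u _ => Finset.sum_comm (f := fun v w => g w u v))]
            exact h1
          rw [h1, h2]; ring
      _ ≤ ∑ u, ∑ v, ∑ w,
          3 * (if u ≠ v ∧ u ≠ w ∧ v ≠ w ∧ FDFedge E u v w then (1:ℝ) else 0) :=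
          Finset.sum_le_sum fun u _ => Finset.sum_le_sum fun v _ =>
            Finset.sum_le_sum fun w _ => hpt u v w
      _ = 3 * ∑ u, ∑ v, ∑ w,
          (if u ≠ v ∧ u ≠ w ∧ v ≠ w ∧ FDFedge E u v w then (1:ℝ) else 0) := by
          simp only [Finset.mul_sum]
      _ ≤ _ := by linarith
  have hG : ∑ u, ∑ v, ∑ w, g u v w =
      3 * ∑ u, (∑ v, e u v) ^ 2 + ∑ u, (∑ v, b u v) ^ 2
        - (3 * ∑ u, ∑ v, e u v + ∑ u, ∑ v, b u v) := by
    simp only [hg, Finset.sum_sub_distrib, Finset.sum_add_distrib, Finset.sum_ite_eq,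
      Finset.mem_univ, if_true, sq, Finset.sum_mul_sum]
    simp only [Finset.mul_sum]
  have k1 : (∑ u, ∑ v, e u v) ^ 2 ≤ (Fintype.card V : ℝ) * ∑ u, (∑ v, e u v) ^ 2 := by
    simpa using sq_sum_le_card_mul_sum_sq (s := (univ : Finset V)) (f := fun u => ∑ v, e u v)
  have k2 : (∑ u, ∑ v, b u v) ^ 2 ≤ (Fintype.card V : ℝ) * ∑ u, (∑ v, b u v) ^ 2 := by
    simpa using sq_sum_le_card_mul_sum_sq (s := (univ : Finset V)) (f := fun u => ∑ v, b u v)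
  rw [hM] at k2 hG
  rw [← hm1] at k1 hG
  have hn : (0 : ℝ) ≤ (Fintype.card V : ℝ) := Nat.cast_nonneg _
  have := mul_le_mul_of_nonneg_left (show _ ≤ _ from (by linarith :
    ∑ u, ∑ v, ∑ w, g u v w ≤ 6 * (fdfCount V E : ℝ))) hn
  rw [hG] at this
  nlinarith

open Classical in
theorem aux_le {V : Type*} [Fintype V] (E : V → V → Prop) :
    underlyingEdgeCount V E ≤ (Fintype.card V).choose 2 := by
  unfold underlyingEdgeCount
  refine (Finset.card_filter_le _ _).trans ?_
  simp

/-- Writing ρ for the underlying edge density, δ_ρ = 2/3 − ρ, and d₃ for the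
edge density of FDF(Γ), one has 4/9 − d₃ ≤ (1/3)δ_ρ − (7/4)δ_ρ² + ε for every
orgraph on n ≥ N vertices. -/
theorem stmt10 :
    ∀ ε : ℝ, ε > 0 → ∃ N : ℕ, ∀ n : ℕ, N ≤ n → ∀ E : Fin n → Fin n → Prop,
      IsOrgraph E →
      (4 : ℝ) / 9 - (fdfCount (Fin n) E : ℝ) / (n.choose 3 : ℝ) ≤
        (1 / 3) * ((2 : ℝ) / 3 - (underlyingEdgeCount (Fin n) E : ℝ) / (n.choose 2 : ℝ))
          - (7 / 4) * ((2 : ℝ) / 3 - (underlyingEdgeCount (Fin n) E : ℝ) / (n.choose 2 : ℝ)) ^ 2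
          + ε := by
  intro ε hε
  obtain ⟨K, hK⟩ := exists_nat_gt (3 / 2 / ε)
  refine ⟨K + 3, fun n hn E hE => ?_⟩
  have hmain := aux_main E hE
  rw [Fintype.card_fin] at hmain
  have hn3 : (3 : ℝ) ≤ n := by exact_mod_cast (by omega : 3 ≤ n)
  have hnK : (K : ℝ) ≤ n - 2 := by
    have : ((K + 3 : ℕ) : ℝ) ≤ n := by exact_mod_cast hn
    push_cast at this; linarith
  have hεn : 3 / 2 ≤ ε * ((n : ℝ) - 2) := by
    rw [div_lt_iff₀ hε] at hK
    nlinarith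
  have hc2 : (n.choose 2 : ℝ) = n * (n - 1) / 2 := Nat.cast_choose_two ℝ n
  have hc3 : (n.choose 3 : ℝ) = n * (n - 1) * (n - 2) / 6 := by
    obtain ⟨k, rfl⟩ : ∃ k, n = k + 3 := ⟨n - 3, by omega⟩
    have h := Nat.choose_succ_right_eq (k + 3) 2
    have h' : ((k + 3).choose 3 : ℝ) * 3 = ((k + 3).choose 2 : ℝ) * (k + 1) := by
      exact_mod_cast h
    rw [hc2] at h'
    push_cast at h' ⊢
    linarith
  have hle : (underlyingEdgeCount (Fin n) E : ℝ) ≤ (n.choose 2 : ℝ) := by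
    have : underlyingEdgeCount (Fin n) E ≤ n.choose 2 := by
      simpa using aux_le E
    exact_mod_cast this
  have p2 : (0 : ℝ) < n * (n - 1) / 2 := by
    have : (0:ℝ) < (n:ℝ) - 1 := by linarith
    positivity
  have p3 : (0 : ℝ) < n * (n - 1) * (n - 2) / 6 := by
    have : (0:ℝ) < (n:ℝ) - 2 := by linarith
    have := p2
    nlinarith
  rw [hc2] at hle ⊢
  rw [hc3]
  set F : ℝ := (fdfCount (Fin n) E : ℝ)
  set m : ℝ := (underlyingEdgeCount (Fin n) E : ℝ)
  obtain ⟨r, hr⟩ : ∃ r : ℝ, r = m / ((n : ℝ) * (n - 1) / 2) := ⟨_, rfl⟩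
  obtain ⟨d, hd⟩ : ∃ d : ℝ, d = F / ((n : ℝ) * (n - 1) * (n - 2) / 6) := ⟨_, rfl⟩
  have hr1 : r ≤ 1 := by rw [hr, div_le_one p2]; exact hle
  rw [← hr, ← hd]
  rw [eq_div_iff p2.ne'] at hr
  rw [eq_div_iff p3.ne'] at hd
  rw [← hr, ← hd] at hmain
  have q : (0:ℝ) < n * (n * (n - 1)) := by
    have : (0:ℝ) < n := by linarith
    have : (0:ℝ) < (n:ℝ) - 1 := by linarith
    positivity
  have key : ((n : ℝ) - 2) * d ≥ (n - 1) * (3 / 4 * r ^ 2 + (1 - r) ^ 2) - 3 * r / 2 - (1 - r) := by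
    refine le_of_mul_le_mul_left ?_ q
    nlinarith
  have q2 : (0:ℝ) < (n:ℝ) - 2 := by linarith
  refine le_of_mul_le_mul_left ?_ q2
  nlinarith [sq_nonneg r, sq_nonneg (1 - r)]
end

section
/- Let Γ be an orgraph whose underlying graph is a complete bipartite graph with parts A and B (i.e., there is exactly one directed edge between every a ∈ A and b ∈ B, and no edges inside A or inside B). If Γ is C⃗4-free, then Γ contains no directed cycle; in particular, if Γ is nonempty and finite, it has a vertex of out-degree 0. -/
open Finset

/-- A C⃗₄-free orientation of a complete bipartite graph contains no directed
cycle; in particular (being finite and nonempty) it has a vertex of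
out-degree 0. -/
theorem stmt14 {V : Type*} [Fintype V] [Nonempty V] (E : V → V → Prop)
    (hor : IsOrgraph E) (A B : Set V)
    (hcover : A ∪ B = Set.univ) (hdisj : Disjoint A B)
    (hbip : ∀ u v : V, (E u v ∨ E v u) ↔ ((u ∈ A ∧ v ∈ B) ∨ (u ∈ B ∧ v ∈ A)))
    (hC4 : ¬ HasInducedC4 E) :
    (¬ ∃ v : V, Relation.TransGen E v v) ∧ (∃ v : V, ∀ w : V, ¬ E v w) := by
  have key : ∀ a b c d : V, E a b → E b c → E c d → E a d := by
    intro a b c d hab hbc hcd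
    obtain ⟨hl, has⟩ := hor
    have hdj : ∀ x, x ∈ A → x ∈ B → False := fun x h1 h2 =>
      Set.disjoint_left.mp hdisj h1 h2
    have h1 := (hbip a b).1 (Or.inl hab)
    have h2 := (hbip b c).1 (Or.inl hbc)
    have h3 := (hbip c d).1 (Or.inl hcd)
    have had : E a d ∨ E d a := by
      rw [hbip]
      grind
    rcases had with h | hda
    · exact h
    · exfalso
      have nac : ¬ (E a c ∨ E c a) := by
        rw [hbip]
        grind
      have nbd : ¬ (E b d ∨ E d b) := by
        rw [hbip]
        grind
      exact hC4 ⟨a, b, c, d, by grind, by grind, by grind, by grind, by grind, by grind,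
        hab, hbc, hcd, hda, has _ _ hab, has _ _ hbc, has _ _ hcd, has _ _ hda,
        fun h => nac (Or.inl h), fun h => nac (Or.inr h),
        fun h => nbd (Or.inl h), fun h => nbd (Or.inr h)⟩
  have short : ∀ v w : V, Relation.TransGen E v w → E v w ∨ ∃ u, E v u ∧ E u w := by
    intro v w h
    induction h with
    | single h => exact Or.inl h
    | tail _ hwx ih =>
      rcases ih with h | ⟨u, h1, h2⟩
      · exact Or.inr ⟨_, h, hwx⟩
      · exact Or.inl (key _ _ _ _ h1 h2 hwx)
  have acyc : ∀ v : V, ¬ Relation.TransGen E v v := by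
    intro v h
    rcases short v v h with h | ⟨u, h1, h2⟩
    · exact hor.1 v h
    · exact hor.2 _ _ h1 h2
  refine ⟨fun ⟨v, h⟩ => acyc v h, ?_⟩
  let r : V → V → Prop := fun x y => Relation.TransGen E y x
  have : IsTrans V r := ⟨fun _ _ _ h1 h2 => Relation.TransGen.trans h2 h1⟩
  have : Std.Irrefl r := ⟨acyc⟩
  have wf : WellFounded r := Finite.wellFounded_of_trans_of_irrefl r
  obtain ⟨m, -, hm⟩ := wf.has_min Set.univ Set.univ_nonempty
  exact ⟨m, fun w hw => hm w (Set.mem_univ _) (Relation.TransGen.single hw)⟩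
end
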